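/- arXiv:1902.05830 — 3 statements merged into one kernel-verified Lean document; each statement's English description precedes it below -/
import Mathlib

section
/- Suppose K is an immediately algebraically closed (IAC) field. Then the following are equivalent: (1) K is valuationally algebraically closed (VAC); (2) for every rank-1 valuation v on the algebraic closure K^alg of K, K is dense in K^alg with respect to v; (3) for every rank-1 valuation v on K, the completion of (K,v) is algebraically closed. -/
open Polynomial

universe u v

/-- A valuation on a field is *nontrivial* if `v x ≠ 1` (multiplicative notation,
corresponding to `v x ≠ 0` in the additive notation) for some nonzero `x`. -/
def IsNontrivialValuation {K : Type*} {Γ : Type*} [Field K]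
    [LinearOrderedCommGroupWithZero Γ] (v : Valuation K Γ) : Prop :=
  ∃ x : K, x ≠ 0 ∧ v x ≠ 1

/-- The value group `vK = v(Kˣ)` of a valuation is divisible: every `γ ∈ vK` has `n`-th
roots in `vK` for every `n ≥ 1` (written multiplicatively, i.e. `nδ = γ` additively). -/
def HasDivisibleValueGroup {K : Type*} {Γ : Type*} [Field K]
    [LinearOrderedCommGroupWithZero Γ] (v : Valuation K Γ) : Prop :=
  ∀ x : K, x ≠ 0 → ∀ n : ℕ, 1 ≤ n → ∃ y : K, y ≠ 0 ∧ v y ^ n = v x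

/-- The residue field `Kv` of a valuation is algebraically closed. -/
def HasAlgClosedResidueField {K : Type*} {Γ : Type*} [Field K]
    [LinearOrderedCommGroupWithZero Γ] (v : Valuation K Γ) : Prop :=
  IsAlgClosed (IsLocalRing.ResidueField v.valuationSubring)

/-- A field `K` is *immediately algebraically closed* (IAC) if for every nontrivial
valuation `v` on `K`, the residue field `Kv` is algebraically closed and the value
group `vK` is divisible. -/
def IsIAC (K : Type u) [Field K] : Prop :=
  ∀ (Γ : Type u) (_ : LinearOrderedCommGroupWithZero Γ) (v : Valuation K Γ),
    IsNontrivialValuation v → HasAlgClosedResidueField v ∧ HasDivisibleValueGroup v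

/-- Given a field embedding `f : K →+* L` and a valuation `w` on `L`, `K` is *dense in `L`
with respect to `w`* if for every `a ∈ L` and every `γ = w c ∈ wL` (`c ≠ 0`) there is
`b ∈ K` with `w (a - b) < γ` (multiplicatively; `w (a - b) > γ` in additive notation). -/
def DenseInWrt {K L : Type*} {Γ : Type*} [Field K] [Field L]
    [LinearOrderedCommGroupWithZero Γ] (f : K →+* L) (w : Valuation L Γ) : Prop :=
  ∀ a : L, ∀ c : L, c ≠ 0 → ∃ b : K, w (a - f b) < w c

/-- A field `K` is *valuationally algebraically closed* (VAC) if for every nontrivial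
valuation `w` on its algebraic closure, `K` is dense in the algebraic closure
with respect to `w`. -/
def IsVAC (K : Type u) [Field K] : Prop :=
  ∀ (Γ : Type u) (_ : LinearOrderedCommGroupWithZero Γ)
    (w : Valuation (AlgebraicClosure K) Γ), IsNontrivialValuation w →
      DenseInWrt (algebraMap K (AlgebraicClosure K)) w

open MonoidWithZeroHom MonoidWithZeroHom.ValueGroup₀

section Extension

/-- Every valuation ring of a field is the trace of a valuation ring of a given extension. -/
theorem ValuationSubring.exists_comap_eq {K L : Type*} [Field K] [Field L] (f : K →+* L)
    (A : ValuationSubring K) : ∃ B : ValuationSubring L, B.comap f = A := by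
  obtain ⟨B, hle, hloc⟩ := (A.toLocalSubring.map f).exists_le_valuationSubring
  have hAB : ∀ x ∈ A, f x ∈ B := fun x hx => hle (Subring.mem_map.mpr ⟨x, hx, rfl⟩)
  refine ⟨B, ValuationSubring.ext _ _ fun x => ⟨fun hx => ?_, hAB x⟩⟩
  by_contra hxA
  have hx0 : x ≠ 0 := fun h => hxA (h ▸ A.zero_mem)
  have hx' : x⁻¹ ∈ A := (A.mem_or_inv_mem x).resolve_left hxA
  let y : (A.toLocalSubring.map f).toSubring := ⟨f x⁻¹, Subring.mem_map.mpr ⟨x⁻¹, hx', rfl⟩⟩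
  have hy : IsUnit (Subring.inclusion hle y) := by
    refine IsUnit.of_mul_eq_one (⟨f x, hx⟩ : B.toLocalSubring.toSubring) (Subtype.ext ?_)
    change f x⁻¹ * f x = 1
    rw [← map_mul, inv_mul_cancel₀ hx0, map_one]
  obtain ⟨⟨z, hz⟩, hyz⟩ := (hloc.map_nonunit y hy).exists_right_inv
  obtain ⟨z', hz', rfl⟩ := Subring.mem_map.mp hz
  have h1 : f x⁻¹ * f z' = 1 := congrArg Subtype.val hyz
  rw [← map_mul, map_eq_one_iff f f.injective, inv_mul_eq_one₀ hx0] at h1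
  exact hxA (h1 ▸ hz')

theorem Valuation.exists_extension_lt_iff {K L Γ : Type*} [Field K] [Field L]
    [LinearOrderedCommGroupWithZero Γ] (f : K →+* L) (v : Valuation K Γ) :
    ∃ B : ValuationSubring L, ∀ x y, B.valuation (f x) < B.valuation (f y) ↔ v x < v y := by
  obtain ⟨B, hB⟩ := v.valuationSubring.exists_comap_eq f
  refine ⟨B, fun x y => ?_⟩
  have h : (B.valuation.comap f).IsEquiv v := by
    rw [Valuation.isEquiv_iff_valuationSubring, ← hB]
    ext z
    simp [Valuation.mem_valuationSubring_iff, ValuationSubring.mem_comap,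
      ValuationSubring.valuation_le_one_iff]
  exact h.lt_iff_lt

end Extension

section RankOne

variable {K Γ : Type*} [Field K] [LinearOrderedCommGroupWithZero Γ]

theorem Valuation.lt_of_valuation_lt (v : Valuation K Γ) {B : ValuationSubring K}
    (h : v.valuationSubring ≤ B) {x y : K} (hxy : B.valuation x < B.valuation y) : v x < v y := by
  by_contra! hyx
  have hx : x ≠ 0 := by
    rintro rfl
    have hy : y = 0 := by simpa using hyx
    simp [hy] at hxy
  have hmem : y / x ∈ B := h <| by
    rw [Valuation.mem_valuationSubring_iff, map_div₀]
    exact div_le_one_of_le₀ hyx zero_le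
  rw [← B.valuation_le_one_iff, map_div₀, div_le_one₀ (by simpa [zero_lt_iff] using hx)] at hmem
  exact hmem.not_gt hxy

theorem isNontrivialValuation_iff (v : Valuation K Γ) :
    IsNontrivialValuation v ↔ v.IsNontrivial := by
  constructor
  · rintro ⟨x, hx, h⟩
    exact ⟨⟨x, by simpa using hx, h⟩⟩
  · rintro ⟨x, hx, h⟩
    exact ⟨x, by simpa using hx, h⟩

theorem Valuation.IsNontrivial.exists_lt_one' {v : Valuation K Γ} (h : v.IsNontrivial) :
    ∃ x : K, x ≠ 0 ∧ v x < 1 := by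
  obtain ⟨x, hx, h⟩ := h
  rcases h.lt_or_gt with h | h
  · exact ⟨x, by simpa using hx, h⟩
  · exact ⟨x⁻¹, by simpa using hx, by rw [map_inv₀]; exact inv_lt_one_of_one_lt₀ h⟩

/-- A nontrivial valuation has rank one iff its value group is archimedean. -/
theorem Valuation.nonempty_rankOne_iff (v : Valuation K Γ) :
    Nonempty v.RankOne ↔ v.IsNontrivial ∧ ∀ x y, 1 < v y → ∃ n : ℕ, v x ≤ v y ^ n := by
  constructor
  · rintro ⟨h⟩
    refine ⟨h.toIsNontrivial, fun x y hy => ?_⟩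
    have : MulArchimedean (ValueGroup₀ (.ofClass v)) :=
      v.nonempty_rankOne_iff_mulArchimedean.mp ⟨h⟩
    have hy' : 1 < v.restrict y := by
      rwa [← map_one v.restrict, Valuation.restrict_lt_iff, map_one]
    obtain ⟨n, hn⟩ := MulArchimedean.arch (v.restrict x) hy'
    refine ⟨n, ?_⟩
    rwa [← map_pow, Valuation.restrict_le_iff, map_pow] at hn
  · rintro ⟨hv, H⟩
    rw [nonempty_rankOne_iff_mulArchimedean]
    refine ⟨fun a b hb => ?_⟩
    obtain ⟨x, rfl⟩ := restrict₀_surjective _ a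
    obtain ⟨y, rfl⟩ := restrict₀_surjective _ b
    change 1 < v.restrict y at hb
    rw [← map_one v.restrict, Valuation.restrict_lt_iff, map_one] at hb
    obtain ⟨n, hn⟩ := H x y hb
    refine ⟨n, ?_⟩
    change v.restrict x ≤ v.restrict y ^ n
    rwa [← map_pow, Valuation.restrict_le_iff, map_pow]

/-- Given `t` with `0 < w t < 1`, either `t` becomes a unit in a proper coarsening of `w`, or
`w` has a coarsening of rank one. -/
theorem Valuation.exists_coarsening (w : Valuation K Γ) {t : K} (ht0 : t ≠ 0) (ht : w t < 1) :
    ∃ B : ValuationSubring K, w.valuationSubring ≤ B ∧ B ≠ ⊤ ∧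
      (1 ≤ B.valuation t ∨ Nonempty B.valuation.RankOne) := by
  have hwt : w t ≠ 0 := by simpa using ht0
  have hwt' : 0 < w t := zero_lt_iff.mpr hwt
  by_cases H : ∀ x, ∃ n : ℕ, w x * w t ^ n ≤ 1
  · let S : Subring K :=
      { carrier := {x | ∀ n : ℕ, w x ^ n * w t ≤ 1}
        one_mem' := fun n => by simpa using ht.le
        zero_mem' := fun n => by
          rcases Nat.eq_zero_or_pos n with rfl | h
          · simpa using ht.le
          · simp [h.ne']
        mul_mem' := fun {x y} hx hy n => by
          rw [map_mul]
          wlog h : w x ≤ w y generalizing x y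
          · rw [mul_comm (w x)]
            exact this hy hx (le_of_not_ge h)
          · calc (w x * w y) ^ n * w t ≤ (w y * w y) ^ n * w t := by gcongr
              _ = w y ^ (2 * n) * w t := by rw [← pow_two, pow_mul]
              _ ≤ 1 := hy _
        add_mem' := fun {x y} hx hy n => by
          rcases le_max_iff.mp (w.map_add x y) with h | h
          · exact le_trans (by gcongr) (hx n)
          · exact le_trans (by gcongr) (hy n)
        neg_mem' := fun {x} hx n => by simpa using hx n }
    have hS : w.valuationSubring.toSubring ≤ S := fun x hx n =>
      mul_le_one' (pow_le_one₀ zero_le hx) ht.le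
    let B := ValuationSubring.ofLE w.valuationSubring S hS
    have hB : ∀ x, x ∈ B ↔ ∀ n : ℕ, w x ^ n * w t ≤ 1 := fun x => Iff.rfl
    have htop : B ≠ ⊤ := by
      intro h
      have : t⁻¹ ∈ B := h ▸ ValuationSubring.mem_top _
      have := (hB _).mp this 2
      rw [map_inv₀, pow_two, mul_assoc, inv_mul_cancel₀ hwt, mul_one] at this
      exact this.not_gt ((one_lt_inv₀ hwt').mpr ht)
    refine ⟨B, hS, htop, Or.inr ?_⟩
    rw [Valuation.nonempty_rankOne_iff]
    refine ⟨not_not.mp fun h => htop ((ValuationSubring.eq_top_iff _).mpr h), fun x y hy => ?_⟩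
    have hyB : y ∉ B := fun h => hy.not_ge ((B.valuation_le_one_iff y).mpr h)
    rw [hB] at hyB
    push Not at hyB
    obtain ⟨n, hn⟩ := hyB
    obtain ⟨k, hk⟩ := H x
    refine ⟨n * k, ?_⟩
    by_contra! hlt
    rw [← map_pow] at hlt
    have := w.lt_of_valuation_lt hS hlt
    rw [map_pow, pow_mul] at this
    have h1 : 1 ≤ (w y ^ n) ^ k * w t ^ k := by
      rw [← mul_pow]
      exact one_le_pow₀ hn.le
    have h2 : (w y ^ n) ^ k * w t ^ k < w x * w t ^ k := by
      have := pow_pos hwt' k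
      gcongr
    exact (h1.trans_lt h2).not_ge hk
  · push Not at H
    obtain ⟨x₀, hx₀⟩ := H
    let S : Subring K :=
      { carrier := {x | ∃ n : ℕ, w x * w t ^ n ≤ 1}
        one_mem' := ⟨0, by simp⟩
        zero_mem' := ⟨0, by simp⟩
        mul_mem' := by
          rintro x y ⟨n, hn⟩ ⟨m, hm⟩
          refine ⟨n + m, ?_⟩
          rw [map_mul, pow_add, mul_mul_mul_comm]
          exact mul_le_one' hn hm
        add_mem' := by
          rintro x y ⟨n, hn⟩ ⟨m, hm⟩
          refine ⟨n + m, ?_⟩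
          have h1 : w t ^ (n + m) ≤ w t ^ n := pow_le_pow_of_le_one zero_le ht.le (by simp)
          have h2 : w t ^ (n + m) ≤ w t ^ m := pow_le_pow_of_le_one zero_le ht.le (by simp)
          rcases le_max_iff.mp (w.map_add x y) with h | h
          · exact (mul_le_mul' h h1).trans hn
          · exact (mul_le_mul' h h2).trans hm
        neg_mem' := by
          rintro x ⟨n, hn⟩
          exact ⟨n, by simpa using hn⟩ }
    have hS : w.valuationSubring.toSubring ≤ S := fun x hx => ⟨0, by simpa using hx⟩
    let B := ValuationSubring.ofLE w.valuationSubring S hS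
    refine ⟨B, hS, ?_, Or.inl ?_⟩
    · intro h
      have : x₀ ∈ B := h ▸ ValuationSubring.mem_top _
      obtain ⟨n, hn⟩ := this
      exact (hx₀ n).not_ge hn
    · have : t⁻¹ ∈ B := ⟨1, by simp [hwt]⟩
      rw [← B.valuation_le_one_iff, map_inv₀] at this
      exact (inv_le_one₀ (by simpa [zero_lt_iff] using ht0)).mp this

end RankOne

section Bounds

variable {K Γ : Type*} [Field K] [LinearOrderedCommGroupWithZero Γ]

theorem Valuation.exists_coeff_le (v : Valuation K Γ) (p : K[X]) :
    ∃ d : K, 1 ≤ v d ∧ ∀ i, v (p.coeff i) ≤ v d := by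
  classical
  obtain ⟨d, hd, hmax⟩ := Finset.exists_max_image (insert 1 (p.support.image p.coeff)) v (by simp)
  have h1 : 1 ≤ v d := by simpa using hmax 1 (by simp)
  refine ⟨d, h1, fun i => ?_⟩
  by_cases hi : p.coeff i = 0
  · simp [hi]
  · exact hmax _ (Finset.mem_insert_of_mem (Finset.mem_image_of_mem _ (mem_support_iff.mpr hi)))

theorem Valuation.le_of_isRoot (v : Valuation K Γ) {p : K[X]} (hp : p.Monic) {x : K}
    (hx : p.IsRoot x) {γ : Γ} (hγ : 1 ≤ γ) (hcoeff : ∀ i, v (p.coeff i) ≤ γ) : v x ≤ γ := by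
  by_contra! hlt
  have hx1 : 1 < v x := hγ.trans_lt hlt
  have hx0 : 0 < v x := zero_lt_one.trans hx1
  have h := hx.eq_zero
  rw [eval_eq_sum_range, Finset.sum_range_succ, hp.coeff_natDegree, one_mul,
    add_eq_zero_iff_eq_neg] at h
  have h' := congrArg v h
  rw [Valuation.map_neg, map_pow] at h'
  refine (v.map_sum_lt (pow_pos hx0 _).ne' fun i hi => ?_).ne h'
  rw [map_mul, map_pow]
  calc v (p.coeff i) * v x ^ i ≤ γ * v x ^ i := by gcongr; exact hcoeff i
    _ < v x * v x ^ i := by gcongr; exact pow_pos hx0 i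
    _ = v x ^ (i + 1) := (pow_succ' _ _).symm
    _ ≤ v x ^ p.natDegree := pow_le_pow_right₀ hx1.le (Finset.mem_range.mp hi)

/-- The value group of the base field is cofinal in that of an algebraic extension. -/
theorem Valuation.exists_le_algebraMap {L : Type*} [Field L] [Algebra K L]
    [Algebra.IsAlgebraic K L] (w : Valuation L Γ) (x : L) :
    ∃ d : K, 1 ≤ w (algebraMap K L d) ∧ w x ≤ w (algebraMap K L d) := by
  obtain ⟨d, hd, hle⟩ := (w.comap (algebraMap K L)).exists_coeff_le (minpoly K x)
  refine ⟨d, hd, w.le_of_isRoot ((minpoly.monic (Algebra.IsIntegral.isIntegral x)).map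
    (algebraMap K L)) ?_ hd fun i => ?_⟩
  · rw [IsRoot, eval_map_algebraMap, minpoly.aeval]
  · rw [coeff_map]
    exact hle i

theorem Valuation.IsNontrivial.comap_algebraMap {L : Type*} [Field L] [Algebra K L]
    [Algebra.IsAlgebraic K L] {w : Valuation L Γ} (hw : w.IsNontrivial) :
    (w.comap (algebraMap K L)).IsNontrivial := by
  obtain ⟨s, hs0, hs⟩ := hw.exists_lt_one'
  obtain ⟨d, hd, hle⟩ := w.exists_le_algebraMap (K := K) s⁻¹
  refine ⟨d, (zero_lt_one.trans_le hd).ne', (lt_of_lt_of_le ?_ hle).ne'⟩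
  rw [map_inv₀]
  exact (one_lt_inv₀ (by simpa [zero_lt_iff] using hs0)).mpr hs

end Bounds

section Residue

/-- An algebraic element integral for a valuation `w` is congruent to an element of the base field
when the residue field of the base field is algebraically closed. -/
theorem exists_valuation_sub_lt_one {K L Γ : Type*} [Field K] [Field L] [Algebra K L]
    [Algebra.IsAlgebraic K L] [LinearOrderedCommGroupWithZero Γ] (w : Valuation L Γ)
    (hk : HasAlgClosedResidueField (w.comap (algebraMap K L))) {a : L} (ha : w a ≤ 1) :
    ∃ b : K, w (a - algebraMap K L b) < 1 := by
  classical
  set v := w.comap (algebraMap K L) with hv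
  have : IsAlgClosed (IsLocalRing.ResidueField v.valuationSubring) := hk
  let φ : v.valuationSubring →+* w.valuationSubring :=
    ((algebraMap K L).comp v.valuationSubring.subtype).codRestrict
      w.valuationSubring.toSubring fun x => x.2
  have hφ : ∀ x, (φ x : L) = algebraMap K L x := fun _ => rfl
  have hloc : IsLocalHom φ := by
    refine ⟨fun x hx => ?_⟩
    rw [(Valuation.valuationSubring.integers v).isUnit_iff_valuation_eq_one]
    exact (Valuation.valuationSubring.integers w).isUnit_iff_valuation_eq_one.mp hx
  obtain ⟨i, hi, hmax⟩ := Finset.exists_max_image (minpoly K a).support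
    (fun i => v ((minpoly K a).coeff i))
    (by simpa using minpoly.ne_zero (Algebra.IsIntegral.isIntegral a))
  rw [mem_support_iff] at hi
  have hvi : 0 < v ((minpoly K a).coeff i) := by simpa [zero_lt_iff] using hi
  obtain ⟨p, hp⟩ : C ((minpoly K a).coeff i)⁻¹ * minpoly K a ∈
      lifts v.valuationSubring.subtype := by
    rw [lifts_iff_coeff_lifts]
    intro j
    suffices h : (C ((minpoly K a).coeff i)⁻¹ * minpoly K a).coeff j ∈ v.valuationSubring from
      ⟨⟨_, h⟩, rfl⟩
    rw [coeff_C_mul, Valuation.mem_valuationSubring_iff, map_mul, map_inv₀, inv_mul_le_one₀ hvi]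
    by_cases hj : (minpoly K a).coeff j = 0
    · simp [hj]
    · exact hmax j (mem_support_iff.mpr hj)
  have hpi : p.coeff i = 1 := by
    have := congrArg (coeff · i) hp
    simp only [coe_mapRingHom, coeff_map, coeff_C_mul, inv_mul_cancel₀ hi] at this
    exact Subtype.ext this
  have hpa : p.eval₂ φ ⟨a, ha⟩ = 0 := by
    refine Subtype.ext ?_
    change w.valuationSubring.subtype _ = _
    rw [hom_eval₂]
    have : w.valuationSubring.subtype.comp φ = (algebraMap K L).comp v.valuationSubring.subtype :=
      rfl
    rw [this, ← eval₂_map, ← coe_mapRingHom, hp]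
    simp [← aeval_def]
  let ψ := IsLocalRing.ResidueField.map φ
  let q := p.map (IsLocalRing.residue v.valuationSubring)
  have hq : q ≠ 0 := fun h => by
    have := congrArg (coeff · i) h
    simp [q, coeff_map, hpi] at this
  have hroot : (q.map ψ).eval (IsLocalRing.residue _ (⟨a, ha⟩ : w.valuationSubring)) = 0 := by
    rw [eval_map, eval₂_map, IsLocalRing.ResidueField.map_comp_residue, ← hom_eval₂, hpa, map_zero]
  have hmem : IsLocalRing.residue _ (⟨a, ha⟩ : w.valuationSubring) ∈ (q.map ψ).roots :=
    (mem_roots (by simpa [Polynomial.map_eq_zero] using hq)).mpr hroot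
  rw [(IsAlgClosed.splits q).roots_map, Multiset.mem_map] at hmem
  obtain ⟨r, -, hr⟩ := hmem
  obtain ⟨b, rfl⟩ := IsLocalRing.residue_surjective r
  refine ⟨b, ?_⟩
  rw [IsLocalRing.ResidueField.map_residue, eq_comm, ← sub_eq_zero, ← map_sub,
    IsLocalRing.residue_eq_zero_iff] at hr
  by_contra! h
  refine (IsLocalRing.mem_maximalIdeal _).mp hr ?_
  rw [(Valuation.valuationSubring.integers w).isUnit_iff_valuation_eq_one]
  exact le_antisymm ((Valuation.valuationSubring.integers w).map_le_one _) h

end Residue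

section Approximation

theorem isVAC_of_rankOne {K : Type u} [Field K] (hIAC : IsIAC K)
    (H : ∀ (Γ : Type u) (_ : LinearOrderedCommGroupWithZero Γ)
      (w : Valuation (AlgebraicClosure K) Γ), Nonempty w.RankOne →
        DenseInWrt (algebraMap K (AlgebraicClosure K)) w) : IsVAC K := by
  intro Γ _ w hw a c hc
  rw [isNontrivialValuation_iff] at hw
  obtain ⟨s, hs0, hs⟩ := hw.exists_lt_one'
  by_cases ha : a = 0
  · exact ⟨0, by simpa [ha, zero_lt_iff] using hc⟩
  have hwa : 0 < w a := by simpa [zero_lt_iff] using ha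
  have hwc : 0 < w c := by simpa [zero_lt_iff] using hc
  classical
  obtain ⟨t, htm, ht⟩ := Finset.exists_min_image {s, c, c⁻¹, a⁻¹} w (by simp)
  simp only [Finset.mem_insert, Finset.mem_singleton, forall_eq_or_imp, forall_eq] at htm ht
  obtain ⟨hts, htc, htc', hta⟩ := ht
  have ht0 : t ≠ 0 := by rcases htm with rfl | rfl | rfl | rfl <;> simp_all
  obtain ⟨B, hB, htop, h⟩ := w.exists_coarsening ht0 (hts.trans_lt hs)
  have hBnt : B.valuation.IsNontrivial :=
    not_not.mp fun h => htop ((ValuationSubring.eq_top_iff _).mpr h)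
  suffices ∃ b, B.valuation (a - algebraMap K _ b) < B.valuation c from
    this.imp fun b hb => w.lt_of_valuation_lt hB hb
  rcases h with h | h
  · have hmono : ∀ {x y}, w x ≤ w y → B.valuation x ≤ B.valuation y := fun hxy => by
      by_contra! hlt
      exact (w.lt_of_valuation_lt hB hlt).not_ge hxy
    have hc1 : 1 ≤ B.valuation c := h.trans (hmono htc)
    have ha1 : B.valuation a ≤ 1 := by
      have := h.trans (hmono hta)
      rw [map_inv₀] at this
      exact (one_le_inv₀ (by simpa [zero_lt_iff] using ha)).mp this
    obtain ⟨b, hb⟩ := exists_valuation_sub_lt_one B.valuation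
      (hIAC _ _ (B.valuation.comap (algebraMap K _))
        ((isNontrivialValuation_iff _).mpr hBnt.comap_algebraMap)).1 ha1
    exact ⟨b, hb.trans_le hc1⟩
  · exact H _ _ B.valuation h a c hc

end Approximation

section Completion

theorem Valuation.exists_mem_roots_sub_lt {F Γ : Type*} [Field F]
    [LinearOrderedCommGroupWithZero Γ] (w : Valuation F Γ) {f : F[X]} (hf : f.Monic)
    (hs : f.Splits) {x : F} {γ : Γ} (h : w (f.eval x) < γ ^ f.natDegree) :
    ∃ a ∈ f.roots, w (x - a) < γ := by
  by_contra! H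
  refine h.not_ge ?_
  rw [hs.eval_eq_prod_roots_of_monic hf, map_multiset_prod, Multiset.map_map,
    hs.natDegree_eq_card_roots]
  conv_lhs => rw [← Multiset.card_map (w ∘ fun a => x - a)]
  refine Multiset.pow_card_le_prod fun y hy => ?_
  obtain ⟨a, ha, rfl⟩ := Multiset.mem_map.mp hy
  exact H a ha

/-- A monic polynomial over a complete valued field taking arbitrarily small values has a root. -/
theorem Valued.exists_isRoot_of_forall_exists_lt {M Γ : Type*} [Field M]
    [LinearOrderedCommGroupWithZero Γ] [Valued M Γ] [CompleteSpace M] {f : M[X]} (hf : f.Monic)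
    (h : ∀ c : M, c ≠ 0 → ∃ b, Valued.v (f.eval b) < Valued.v c) : ∃ b, f.IsRoot b := by
  classical
  obtain ⟨B, hB⟩ := Valuation.exists_extension_lt_iff (algebraMap M (AlgebraicClosure M))
    (Valued.v : Valuation M Γ)
  set W := B.valuation
  set g := f.map (algebraMap M (AlgebraicClosure M)) with hg
  have hclose : ∀ c : M, c ≠ 0 → ∃ a ∈ g.roots, ∃ b : M,
      W (algebraMap M _ b - a) < W (algebraMap M _ c) ∧
        Valued.v (f.eval b) < Valued.v c := by
    intro c hc
    obtain ⟨e, he0, hec, hen⟩ : ∃ e : M, e ≠ 0 ∧ (Valued.v e : Γ) ≤ Valued.v c ∧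
        (Valued.v e : Γ) ≤ Valued.v (c ^ f.natDegree) := by
      rcases le_total (Valued.v c : Γ) (Valued.v (c ^ f.natDegree)) with h | h
      · exact ⟨c, hc, le_rfl, h⟩
      · exact ⟨c ^ f.natDegree, pow_ne_zero _ hc, h, le_rfl⟩
    obtain ⟨b, hb⟩ := h e he0
    have hW : W (g.eval (algebraMap M _ b)) < W (algebraMap M _ c) ^ g.natDegree := by
      rw [hg, eval_map_algebraMap, aeval_algebraMap_apply, aeval_def, Algebra.algebraMap_self,
        eval₂_id, ← map_pow, ← map_pow, hB, natDegree_map]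
      exact hb.trans_le hen
    obtain ⟨a, ha, hab⟩ := W.exists_mem_roots_sub_lt (hf.map _) (IsAlgClosed.splits _) hW
    exact ⟨a, ha, b, hab, hb.trans_le hec⟩
  obtain ⟨a, ha⟩ : ∃ a, ∀ c : M, c ≠ 0 → ∃ b : M,
      W (algebraMap M _ b - a) < W (algebraMap M _ c) ∧
        Valued.v (f.eval b) < Valued.v c := by
    by_contra! H
    choose c hc0 hc using H
    obtain ⟨a₀, ha₀, -⟩ := hclose 1 one_ne_zero
    obtain ⟨m, -, hm⟩ := Finset.exists_min_image g.roots.toFinset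
      (fun a => (Valued.v (c a) : Γ)) ⟨a₀, by simpa using ha₀⟩
    obtain ⟨a, ha, b, hab, hb⟩ := hclose (c m) (hc0 m)
    have hle := hm a (by simpa using ha)
    refine (hc a b (hab.trans_le ?_)).not_gt (hb.trans_le hle)
    by_contra! hlt
    exact ((hB _ _).mp hlt).not_ge hle
  let S : {c : M // c ≠ 0} → Set M := fun c =>
    {b | W (algebraMap M _ b - a) < W (algebraMap M _ c) ∧ Valued.v (f.eval b) < Valued.v c.1}
  have hmono : ∀ c d : {c : M // c ≠ 0}, (Valued.v c.1 : Γ) ≤ Valued.v d.1 → S c ⊆ S d := by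
    intro c d hcd b hb
    refine ⟨hb.1.trans_le ?_, hb.2.trans_le hcd⟩
    by_contra! hlt
    exact ((hB _ _).mp hlt).not_ge hcd
  let 𝓕 : Filter M := ⨅ c, Filter.principal (S c)
  have hmem : ∀ c, S c ∈ 𝓕 := fun c => Filter.mem_iInf_of_mem c (Filter.mem_principal_self _)
  have : Nonempty {c : M // c ≠ 0} := ⟨⟨1, one_ne_zero⟩⟩
  have hne : 𝓕.NeBot := by
    refine Filter.iInf_neBot_of_directed (fun c d => ?_) fun c => ?_
    · rcases le_total (Valued.v c.1 : Γ) (Valued.v d.1) with h | h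
      · exact ⟨c, le_rfl, Filter.principal_mono.mpr (hmono c d h)⟩
      · exact ⟨d, Filter.principal_mono.mpr (hmono d c h), le_rfl⟩
    · exact Filter.principal_neBot_iff.mpr (ha c c.2)
  have hcauchy : Cauchy 𝓕 := by
    rw [Valued.cauchy_iff]
    refine ⟨hne, fun γ => ?_⟩
    obtain ⟨c, hc⟩ := restrict₀_surjective _ (γ : ValueGroup₀ (.ofClass (Valued.v : Valuation M Γ)))
    have hc0 : c ≠ 0 := by
      rintro rfl
      exact γ.ne_zero (by rw [← hc]; exact map_zero _)
    refine ⟨S ⟨c, hc0⟩, hmem _, fun x hx y hy => ?_⟩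
    rw [← hc]
    change Valued.v.restrict _ < Valued.v.restrict _
    rw [Valuation.restrict_lt_iff, ← hB, map_sub,
      ← sub_sub_sub_cancel_right _ _ a]
    exact W.map_sub_lt hy.1 hx.1
  obtain ⟨b, hb⟩ := CompleteSpace.complete hcauchy
  refine ⟨b, ?_⟩
  by_contra hfb
  have h1 : ∀ᶠ x in 𝓕, (Valued.v (f.eval x) : Γ) = Valued.v (f.eval b) :=
    hb (f.continuous.continuousAt (Valued.locally_const ((Valuation.ne_zero_iff _).mpr hfb)))
  obtain ⟨x, hx, hx'⟩ := (h1.and (hmem ⟨_, hfb⟩)).exists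
  exact hx'.2.ne hx

end Completion

section Valued

open Topology

theorem Valued.eventually_sub_lt {R Γ : Type*} [Field R] [LinearOrderedCommGroupWithZero Γ]
    [Valued R Γ] (x : R) {c : R} (hc : c ≠ 0) :
    ∀ᶠ y in 𝓝 x, (Valued.v (y - x) : Γ) < Valued.v c := by
  have h : (Valued.v.restrict c : ValueGroup₀ (.ofClass (Valued.v : Valuation R Γ))) ≠ 0 :=
    (Valuation.ne_zero_iff _).mpr hc
  refine Valued.mem_nhds.mpr ⟨Units.mk0 _ h, fun y hy => ?_⟩
  exact (Valuation.restrict_lt_iff _).mp hy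

theorem Valued.mem_nhds_iff_exists_sub_lt {R Γ : Type*} [Field R]
    [LinearOrderedCommGroupWithZero Γ] [Valued R Γ] {x : R} {s : Set R} :
    s ∈ 𝓝 x ↔ ∃ c : R, c ≠ 0 ∧ ∀ y, (Valued.v (y - x) : Γ) < Valued.v c → y ∈ s := by
  refine ⟨fun h => ?_, fun ⟨c, hc, h⟩ => Filter.mem_of_superset (eventually_sub_lt x hc) h⟩
  obtain ⟨γ, hγ⟩ := Valued.mem_nhds.mp h
  obtain ⟨c, hc⟩ := restrict₀_surjective _ (γ : ValueGroup₀ (.ofClass (Valued.v : Valuation R Γ)))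
  refine ⟨c, ?_, fun y hy => hγ ?_⟩
  · rintro rfl
    exact γ.ne_zero (by rw [← hc]; exact map_zero _)
  · change _ < (γ : ValueGroup₀ (.ofClass (Valued.v : Valuation R Γ)))
    rw [← hc]
    exact (Valuation.restrict_lt_iff _).mpr hy

theorem Valuation.exists_eval_sub_lt {L Γ : Type*} [Field L] [LinearOrderedCommGroupWithZero Γ]
    (w : Valuation L Γ) (p : L[X]) (a : L) {c : L} (hc : c ≠ 0) :
    ∃ δ : L, δ ≠ 0 ∧ ∀ x, w (x - a) < w δ → w (p.eval x - p.eval a) < w c := by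
  let _ : Valued L Γ := Valued.mk' w
  have h := p.continuous.tendsto a (Valued.eventually_sub_lt (p.eval a) hc)
  exact Valued.mem_nhds_iff_exists_sub_lt.mp h

theorem Valued.exists_coe_sub_lt {K Γ : Type*} [Field K] [LinearOrderedCommGroupWithZero Γ]
    [Valued K Γ] (x : UniformSpace.Completion K) {c : K} (hc : c ≠ 0) :
    ∃ y : K, (Valued.v (x - y) : Γ) < Valued.v c := by
  have hc' : (c : UniformSpace.Completion K) ≠ 0 := by
    rw [← (Valued.v : Valuation (UniformSpace.Completion K) Γ).ne_zero_iff,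
      Valued.valuedCompletion_apply]
    simpa using hc
  obtain ⟨_, ⟨y, rfl⟩, hz⟩ := UniformSpace.Completion.denseRange_coe.inter_nhds_nonempty
    (Valued.eventually_sub_lt x hc')
  refine ⟨y, ?_⟩
  rw [Valuation.map_sub_swap]
  simpa using hz

theorem Valued.exists_coe_valuation_eq {K Γ : Type*} [Field K]
    [LinearOrderedCommGroupWithZero Γ] [Valued K Γ] (x : UniformSpace.Completion K) :
    ∃ r : K, (Valued.v x : Γ) = Valued.v r :=
  Valued.exists_coe_eq_v x

end Valued

section AlgClosed

open UniformSpace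

theorem Valued.exists_monic_coeff_sub_lt {K Γ : Type*} [Field K]
    [LinearOrderedCommGroupWithZero Γ] [Valued K Γ] {f : (Completion K)[X]} (hf : f.Monic)
    {c : K} (hc : c ≠ 0) :
    ∃ g : K[X], g.Monic ∧ g.natDegree = f.natDegree ∧
      ∀ i, (Valued.v (f.coeff i - (g.coeff i : Completion K)) : Γ) < Valued.v c := by
  have hc' : (0 : Γ) < Valued.v c := by simpa [zero_lt_iff] using hc
  choose y hy using fun i => Valued.exists_coe_sub_lt (f.coeff i) hc
  set p : K[X] := ∑ i ∈ Finset.range f.natDegree, monomial i (y i) with hp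
  have hdeg : p.degree < f.natDegree := by
    refine (degree_sum_le _ _).trans_lt ((Finset.sup_lt_iff (WithBot.bot_lt_coe _)).mpr ?_)
    exact fun i hi => (degree_monomial_le _ _).trans_lt
      (Nat.cast_lt.mpr (Finset.mem_range.mp hi))
  have hpc : ∀ i, p.coeff i = if i < f.natDegree then y i else 0 := by
    intro i
    simp [hp, coeff_monomial]
  refine ⟨X ^ f.natDegree + p, monic_X_pow_add hdeg, ?_, fun i => ?_⟩
  · rw [natDegree_add_eq_left_of_degree_lt (by rwa [degree_X_pow]), natDegree_X_pow]
  · rw [coeff_add, coeff_X_pow, hpc]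
    rcases lt_trichotomy i f.natDegree with h | rfl | h
    · simpa [h, h.ne] using hy i
    · have : ((1 : K) : Completion K) = 1 := rfl
      simpa [hf.coeff_natDegree, this] using hc'
    · simpa [h.not_gt, h.ne', coeff_eq_zero_of_natDegree_lt h] using hc'

theorem IsVAC.isAlgClosed_completion {K : Type u} [Field K] {Γ : Type*}
    [LinearOrderedCommGroupWithZero Γ] [Valued K Γ] (h : IsVAC K)
    (hv : (Valued.v : Valuation K Γ).IsNontrivial) : IsAlgClosed (Completion K) := by
  refine IsAlgClosed.of_exists_root _ fun f hf hirr => ?_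
  refine Valued.exists_isRoot_of_forall_exists_lt hf fun c hc => ?_
  obtain ⟨c', hcc'⟩ := Valued.exists_coe_valuation_eq (Γ := Γ) c
  rw [hcc']
  have hc' : c' ≠ 0 := by
    rw [← (Valued.v : Valuation K Γ).ne_zero_iff, ← hcc']
    exact (Valuation.ne_zero_iff _).mpr hc
  clear hcc' hc c
  obtain ⟨d', hd1', hfd'⟩ := Valuation.exists_coeff_le (Valued.v : Valuation (Completion K) Γ) f
  obtain ⟨d, hdd'⟩ := Valued.exists_coe_valuation_eq (Γ := Γ) d'
  rw [hdd'] at hd1' hfd'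
  have hd0 : (0 : Γ) < Valued.v d := zero_lt_one.trans_le hd1'
  have hd : d ≠ 0 := by simpa [zero_lt_iff] using hd0
  obtain ⟨e, he, he1, hec⟩ : ∃ e : K, e ≠ 0 ∧ (Valued.v e : Γ) ≤ 1 ∧
      (Valued.v e * Valued.v d ^ f.natDegree : Γ) ≤ Valued.v c' := by
    have hvd : (0 : Γ) < Valued.v d ^ f.natDegree := pow_pos hd0 _
    rcases le_total (Valued.v (c' / d ^ f.natDegree)) (1 : Γ) with h | h
    · exact ⟨_, div_ne_zero hc' (pow_ne_zero _ hd), h, by simp [hvd.ne']⟩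
    · refine ⟨1, one_ne_zero, by simp, ?_⟩
      rw [map_div₀, map_pow, one_le_div₀ hvd] at h
      simpa using h
  obtain ⟨g, hg, hgn, hfg⟩ := Valued.exists_monic_coeff_sub_lt hf he
  have hgd : ∀ i, (Valued.v (g.coeff i) : Γ) ≤ Valued.v d := fun i => by
    rw [← Valued.valuedCompletion_apply, ← sub_sub_cancel (f.coeff i) (g.coeff i : Completion K)]
    exact Valuation.map_sub_le _ (hfd' i) ((hfg i).le.trans (he1.trans hd1'))
  obtain ⟨B, hB⟩ := Valuation.exists_extension_lt_iff (algebraMap K (AlgebraicClosure K))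
    (Valued.v : Valuation K Γ)
  have hB' : ∀ x y, B.valuation (algebraMap K _ x) ≤ B.valuation (algebraMap K _ y) ↔
      (Valued.v x : Γ) ≤ Valued.v y := fun x y => by
    rw [← not_lt, hB, not_lt]
  obtain ⟨a, ha⟩ := IsAlgClosed.exists_aeval_eq_zero (AlgebraicClosure K) g <|
    (natDegree_pos_iff_degree_pos.mp (hgn ▸ hirr.natDegree_pos)).ne'
  have hroot : (g.map (algebraMap K (AlgebraicClosure K))).IsRoot a := by
    rwa [IsRoot, eval_map_algebraMap]
  have had : B.valuation a ≤ B.valuation (algebraMap K _ d) := by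
    refine B.valuation.le_of_isRoot (hg.map (algebraMap K _)) hroot ?_ fun i => ?_
    · rw [← map_one B.valuation, ← map_one (algebraMap K _), hB', map_one]
      exact hd1'
    · rw [coeff_map, hB']
      exact hgd i
  obtain ⟨δ, hδ, hδa⟩ := B.valuation.exists_eval_sub_lt (g.map (algebraMap K _)) a
    (c := algebraMap K _ c') (by simpa using hc')
  obtain ⟨ε, hε, hεδ, hεd⟩ : ∃ ε, ε ≠ 0 ∧ B.valuation ε ≤ B.valuation δ ∧
      B.valuation ε ≤ B.valuation (algebraMap K _ d) := by
    rcases le_total (B.valuation δ) (B.valuation (algebraMap K _ d)) with h | h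
    · exact ⟨δ, hδ, le_rfl, h⟩
    · exact ⟨_, by simpa using hd, h, le_rfl⟩
  have hBv : IsNontrivialValuation B.valuation := by
    obtain ⟨s, hs0, hs⟩ := hv.exists_lt_one'
    refine ⟨algebraMap K _ s, by simpa using hs0, ?_⟩
    rw [← map_one B.valuation, ← map_one (algebraMap K _)]
    exact ((hB _ _).mpr (by simpa using hs)).ne
  obtain ⟨b, hb⟩ := h _ _ B.valuation hBv a ε hε
  have hgb : (Valued.v (g.eval b) : Γ) < Valued.v c' := by
    have := hδa (algebraMap K _ b) (by rw [Valuation.map_sub_swap]; exact hb.trans_le hεδ)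
    rwa [hroot.eq_zero, sub_zero, eval_map_algebraMap, aeval_algebraMap_apply, aeval_def,
      Algebra.algebraMap_self, eval₂_id, hB] at this
  have hbd : (Valued.v b : Γ) ≤ Valued.v d := by
    rw [← hB', ← sub_sub_cancel a (algebraMap K _ b)]
    exact Valuation.map_sub_le _ had (hb.le.trans hεd)
  refine ⟨b, ?_⟩
  have heval : f.eval (b : Completion K) = (f - g.map Completion.coeRingHom).eval (b : Completion K)
      + (g.eval b : K) := by
    have : (g.map Completion.coeRingHom).eval (b : Completion K) = (g.eval b : K) :=
      eval_map_apply (f := Completion.coeRingHom) b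
    rw [eval_sub, this, sub_add_cancel]
  rw [heval]
  refine Valuation.map_add_lt _ ?_ (by rwa [Valued.valuedCompletion_apply])
  have hdeg : (f - g.map Completion.coeRingHom).natDegree < f.natDegree + 1 :=
    Nat.lt_succ_of_le <| (natDegree_sub_le _ _).trans <|
      max_le le_rfl (natDegree_map_le.trans hgn.le)
  rw [eval_eq_sum_range' hdeg]
  refine Valuation.map_sum_lt _ ((Valuation.ne_zero_iff _).mpr hc') fun i hi => ?_
  rw [map_mul, map_pow, Valued.valuedCompletion_apply, coeff_sub, coeff_map]
  calc _ ≤ Valued.v (f.coeff i - (g.coeff i : Completion K)) * (Valued.v d : Γ) ^ i := by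
        gcongr; exact le_rfl
    _ < Valued.v e * (Valued.v d : Γ) ^ i := by
        have := pow_pos hd0 i
        gcongr
        exact hfg i
    _ ≤ Valued.v e * (Valued.v d : Γ) ^ f.natDegree := by
        gcongr
        exact Nat.lt_succ_iff.mp (Finset.mem_range.mp hi)
    _ ≤ Valued.v c' := hec

theorem Valued.exists_prod_X_sub_C_coeff_sub_lt {K Γ : Type*} [Field K]
    [LinearOrderedCommGroupWithZero Γ] [Valued K Γ] (s : Multiset (Completion K)) {c : K}
    (hc : c ≠ 0) :
    ∃ t : Multiset K, t.card = s.card ∧ ∀ i, (Valued.v ((s.map (X - C ·)).prod.coeff i -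
      ((t.map (X - C ·)).prod.coeff i : Completion K)) : Γ) < Valued.v c := by
  induction s using Multiset.induction_on generalizing c with
  | empty =>
    refine ⟨0, rfl, fun i => ?_⟩
    have h0 : ((0 : K) : Completion K) = 0 := rfl
    have h1 : ((1 : K) : Completion K) = 1 := rfl
    have hc' : (0 : Γ) < Valued.v c := by simpa [zero_lt_iff] using hc
    by_cases hi : i = 0 <;> simp [coeff_one, hi, h0, h1, hc']
  | cons a s ih =>
    obtain ⟨d', hd1', hd'⟩ := Valuation.exists_coeff_le (Valued.v : Valuation (Completion K) Γ)
      (s.map (X - C ·)).prod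
    obtain ⟨d, hd1, hda, hd⟩ : ∃ d : K, (1 : Γ) ≤ Valued.v d ∧ (Valued.v a : Γ) ≤ Valued.v d ∧
        ∀ i, (Valued.v ((s.map (X - C ·)).prod.coeff i) : Γ) ≤ Valued.v d := by
      rcases le_total (Valued.v a : Γ) (Valued.v d') with h | h
      · obtain ⟨d, hd⟩ := Valued.exists_coe_valuation_eq (Γ := Γ) d'
        exact ⟨d, hd ▸ hd1', hd ▸ h, fun i => hd ▸ hd' i⟩
      · obtain ⟨d, hd⟩ := Valued.exists_coe_valuation_eq (Γ := Γ) a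
        exact ⟨d, hd ▸ hd1'.trans h, hd ▸ le_rfl, fun i => hd ▸ (hd' i).trans h⟩
    have hd0 : (0 : Γ) < Valued.v d := zero_lt_one.trans_le hd1
    have hdne : d ≠ 0 := by simpa [zero_lt_iff] using hd0
    obtain ⟨e, he, he1, hec⟩ : ∃ e : K, e ≠ 0 ∧ (Valued.v e : Γ) ≤ 1 ∧
        (Valued.v e * Valued.v d : Γ) ≤ Valued.v c := by
      rcases le_total (Valued.v (c / d)) (1 : Γ) with h | h
      · exact ⟨_, div_ne_zero hc hdne, h, by simp [hd0.ne']⟩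
      · refine ⟨1, one_ne_zero, by simp, ?_⟩
        rw [map_div₀, one_le_div₀ hd0] at h
        simpa using h
    have hec' : (Valued.v e : Γ) ≤ Valued.v c := (le_mul_of_one_le_right' hd1).trans hec
    have hmul : ∀ {x y : Γ}, x < Valued.v e → y ≤ Valued.v d → x * y < Valued.v c :=
      fun {x y} hx hy => calc
        x * y ≤ x * Valued.v d := by gcongr
        _ < Valued.v e * Valued.v d := by gcongr
        _ ≤ Valued.v c := hec
    obtain ⟨t, ht, hst⟩ := ih he
    obtain ⟨b, hb⟩ := Valued.exists_coe_sub_lt (Γ := Γ) a he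
    refine ⟨b ::ₘ t, by simp [ht], fun i => ?_⟩
    rw [Multiset.map_cons, Multiset.prod_cons, Multiset.map_cons, Multiset.prod_cons]
    set P := (s.map (X - C ·)).prod
    set Q := (t.map (X - C ·)).prod
    have hQ : ∀ i, (Valued.v (Q.coeff i : Completion K) : Γ) ≤ Valued.v d := fun i => by
      rw [← sub_sub_cancel (P.coeff i) (Q.coeff i : Completion K)]
      exact Valuation.map_sub_le _ (hd i) ((hst i).le.trans (he1.trans hd1))
    have key : ∀ i, (Valued.v (a * P.coeff i - (b * Q.coeff i : K)) : Γ) < Valued.v c := by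
      intro i
      have : a * P.coeff i - (b * Q.coeff i : K) =
          (P.coeff i - (Q.coeff i : Completion K)) * a + (a - b) * (Q.coeff i : Completion K) := by
        rw [Completion.coe_mul]
        ring
      rw [this]
      refine Valuation.map_add_lt _ ?_ ?_
      · rw [map_mul]
        exact hmul (hst i) hda
      · rw [map_mul]
        exact hmul hb (hQ i)
    rcases i with _ | i
    · have := key 0
      rw [Valuation.map_sub_swap] at this
      simpa [mul_coeff_zero, Completion.coe_neg, neg_add_eq_sub] using this
    · have : ((X - C a) * P).coeff (i + 1) - (((X - C b) * Q).coeff (i + 1) : K) =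
          (P.coeff i - (Q.coeff i : Completion K)) -
            (a * P.coeff (i + 1) - (b * Q.coeff (i + 1) : K)) := by
        simp only [sub_mul, coeff_sub, coeff_X_mul, coeff_C_mul, Completion.coe_sub]
        ring
      rw [this]
      exact Valuation.map_sub_lt _ ((hst i).trans_le hec') (key _)

/-- If the completion of a valued field is algebraically closed, then the field is dense in every
algebraic extension, for every extension of the valuation. -/
theorem Valued.denseInWrt_of_isAlgClosed_completion {K L Γ : Type*} [Field K] [Field L]
    [Algebra K L] [Algebra.IsAlgebraic K L] [LinearOrderedCommGroupWithZero Γ] [Valued K Γ]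
    [IsAlgClosed (Completion K)] {w : Valuation L Γ}
    (hw : ∀ x, w (algebraMap K L x) = Valued.v x) : DenseInWrt (algebraMap K L) w := by
  intro a c hc
  obtain ⟨c', hc', hcc'⟩ : ∃ c' : K, c' ≠ 0 ∧ w (algebraMap K L c') ≤ w c := by
    obtain ⟨x, hx1, hx⟩ := w.exists_le_algebraMap (K := K) c⁻¹
    refine ⟨x⁻¹, inv_ne_zero ?_, ?_⟩
    · rintro rfl
      simp at hx1
    · rw [map_inv₀] at hx
      rw [map_inv₀, map_inv₀]
      exact inv_le_of_inv_le₀ (by simpa [zero_lt_iff] using hc) hx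
  obtain ⟨d, hd1, had⟩ := w.exists_le_algebraMap (K := K) a
  have hd0 : 0 < w (algebraMap K L d) := zero_lt_one.trans_le hd1
  have hd : d ≠ 0 := by
    rintro rfl
    simp at hd1
  have hf := minpoly.monic (Algebra.IsIntegral.isIntegral (R := K) a)
  set f := minpoly K a
  set n := f.natDegree
  obtain ⟨t, ht, hft⟩ := Valued.exists_prod_X_sub_C_coeff_sub_lt (Γ := Γ)
    (f.map Completion.coeRingHom).roots (div_ne_zero (pow_ne_zero n hc') (pow_ne_zero n hd))
  have hs := IsAlgClosed.splits (f.map (Completion.coeRingHom (α := K)))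
  rw [← hs.natDegree_eq_card_roots, natDegree_map] at ht
  set g := (t.map (X - C ·)).prod with hg
  have hgm : g.Monic := monic_multisetProd_X_sub_C t
  have hgn : g.natDegree = n := by rw [hg, natDegree_multiset_prod_X_sub_C_eq_card, ht]
  have hfg : ∀ i, w (algebraMap K L ((g - f).coeff i)) <
      w (algebraMap K L (c' ^ n / d ^ n)) := by
    intro i
    have := hft i
    rw [← hs.eq_prod_roots_of_monic (hf.map _), coeff_map] at this
    change Valued.v ((f.coeff i : Completion K) - _) < _ at this
    rwa [← Completion.coe_sub, Valued.valuedCompletion_apply, ← coeff_sub, ← hw, ← hw,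
      ← neg_sub, coeff_neg, map_neg, Valuation.map_neg] at this
  have hga : w ((g.map (algebraMap K L)).eval a) < w (algebraMap K L c') ^ n := by
    have hev : (g.map (algebraMap K L)).eval a = ((g - f).map (algebraMap K L)).eval a := by
      rw [eval_map_algebraMap, eval_map_algebraMap, map_sub, minpoly.aeval, sub_zero]
    have hdeg : ((g - f).map (algebraMap K L)).natDegree < n + 1 :=
      Nat.lt_succ_of_le <| natDegree_map_le.trans <| (natDegree_sub_le _ _).trans <|
        max_le hgn.le le_rfl
    rw [hev, eval_eq_sum_range' hdeg]
    refine Valuation.map_sum_lt _ (by simpa using fun h => absurd h hc') fun i hi => ?_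
    rw [map_mul, map_pow, coeff_map]
    calc _ ≤ w (algebraMap K L ((g - f).coeff i)) * w (algebraMap K L d) ^ i := by gcongr
      _ < w (algebraMap K L (c' ^ n / d ^ n)) * w (algebraMap K L d) ^ i := by
          have := pow_pos hd0 i
          gcongr
          exact hfg i
      _ ≤ w (algebraMap K L (c' ^ n / d ^ n)) * w (algebraMap K L d) ^ n := by
          gcongr
          exact Nat.lt_succ_iff.mp (Finset.mem_range.mp hi)
      _ = w (algebraMap K L c') ^ n := by
          rw [← map_pow, ← map_pow, ← map_mul, ← map_pow, ← map_mul,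
            div_mul_cancel₀ _ (pow_ne_zero n hd), map_pow, map_pow]
  have hgs : g.Splits := Splits.multisetProd fun p hp => by
    obtain ⟨b, -, rfl⟩ := Multiset.mem_map.mp hp
    exact Splits.X_sub_C b
  obtain ⟨r, hr, har⟩ := w.exists_mem_roots_sub_lt (hgm.map _) (hgs.map _)
    (by rwa [natDegree_map, hgn])
  rw [hgs.roots_map, Multiset.mem_map] at hr
  obtain ⟨b, -, rfl⟩ := hr
  exact ⟨b, har.trans_le hcc'⟩

end AlgClosed

set_option synthInstance.maxHeartbeats 1000000 in
/-- For an IAC field `K`, the following are equivalent: (1) `K` is VAC;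
(2) for every rank-1 valuation `w` on the algebraic closure of `K`, `K` is dense in its
algebraic closure with respect to `w`; (3) for every rank-1 valuation `v` on `K`, the
completion of `(K, v)` is algebraically closed. -/
theorem isVAC_iff_rankOne_criteria {K : Type u} [Field K] (hIAC : IsIAC K) :
    (IsVAC K ↔
      ∀ (Γ : Type u) (_ : LinearOrderedCommGroupWithZero Γ)
        (w : Valuation (AlgebraicClosure K) Γ), Nonempty w.RankOne →
        DenseInWrt (algebraMap K (AlgebraicClosure K)) w) ∧
    (IsVAC K ↔
      ∀ (Γ : Type u) (_ : LinearOrderedCommGroupWithZero Γ)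
        (v : Valuation K Γ), Nonempty v.RankOne →
        letI : Valued K Γ := Valued.mk' v
        IsAlgClosed (UniformSpace.Completion K)) := by
  refine ⟨⟨fun h Γ _ w hw => ?_, isVAC_of_rankOne hIAC⟩, fun h Γ _ v hv => ?_,
    fun H => isVAC_of_rankOne hIAC fun Γ _ w hw => ?_⟩
  · rw [Valuation.nonempty_rankOne_iff] at hw
    exact h Γ _ w ((isNontrivialValuation_iff w).mpr hw.1)
  · rw [Valuation.nonempty_rankOne_iff] at hv
    let _ : Valued K Γ := Valued.mk' v
    exact h.isAlgClosed_completion hv.1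
  · rw [Valuation.nonempty_rankOne_iff] at hw
    have := H Γ _ (w.comap (algebraMap K _)) <| (Valuation.nonempty_rankOne_iff _).mpr
      ⟨hw.1.comap_algebraMap, fun x y hy => hw.2 _ _ hy⟩
    let _ : Valued K Γ := Valued.mk' (w.comap (algebraMap K _))
    exact Valued.denseInWrt_of_isAlgClosed_completion fun _ => rfl
end

section
/- Let p be a prime and let (K,v) be a valued field whose multiplicative group K^× is p-divisible, i.e. every nonzero a ∈ K has a p-th root in K. Let L be the completion of K with respect to the valuation topology of v. Then the multiplicative group L^× is p-divisible: every nonzero element of L has a p-th root in L. -/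
open Polynomial

universe u v

/-- If a monic polynomial of degree `n` takes values smaller than `γ ^ n` at `n + 1` points,
then two of these points are at distance less than `γ`. -/
theorem Valuation.exists_sub_lt_of_eval_lt {F Γ : Type*} [Field F]
    [LinearOrderedCommGroupWithZero Γ] (w : Valuation F Γ) {f : F[X]} (hf : f.Monic)
    {s : Finset F} (hs : s.card = f.natDegree + 1) {γ : Γ} (hγ : γ ≠ 0)
    (hsf : ∀ x ∈ s, w (f.eval x) < γ ^ f.natDegree) :
    ∃ x ∈ s, ∃ y ∈ s, x ≠ y ∧ w (x - y) < γ := by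
  classical
  by_contra! hsep
  have hsum := Lagrange.leadingCoeff_eq_sum (s := s) (v := id) (P := f)
    Function.injective_id.injOn (by rw [hs, degree_eq_natDegree hf.ne_zero]; rfl)
  have hlt : w f.leadingCoeff < 1 := by
    rw [hsum]
    refine w.map_sum_lt one_ne_zero fun x hx ↦ ?_
    have hprod : γ ^ f.natDegree ≤ w (∏ y ∈ s.erase x, (id x - id y)) := by
      have hcard : (s.erase x).card = f.natDegree := by
        rw [Finset.card_erase_of_mem hx, hs, Nat.add_sub_cancel]
      rw [map_prod, ← hcard]
      exact Finset.pow_card_le_prod _ _ _ fun y hy ↦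
        hsep x hx y (Finset.mem_of_mem_erase hy) (Finset.ne_of_mem_erase hy).symm
    rw [map_div₀]
    have hpos : 0 < γ ^ f.natDegree := pow_pos (zero_lt_iff.mpr hγ) _
    rw [div_lt_one₀ (hpos.trans_le hprod)]
    exact (hsf x hx).trans_le hprod
  rw [hf.leadingCoeff, map_one] at hlt
  exact lt_irrefl _ hlt

/-- An ultrafilter along which the values of a monic polynomial tend to `0` contains
balls of arbitrarily small radius. -/
theorem Valuation.exists_ball_mem_ultrafilter {F Γ : Type*} [Field F]
    [LinearOrderedCommGroupWithZero Γ] (w : Valuation F Γ) {f : F[X]} (hf : f.Monic)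
    (U : Ultrafilter F) {γ : Γ} (hγ : γ ≠ 0)
    (hU : {x | w (f.eval x) < γ ^ f.natDegree} ∈ U) :
    ∃ x, {y | w (y - x) < γ} ∈ U := by
  classical
  by_contra! hball
  have hex : ∀ n : ℕ, ∃ s : Finset F, s.card = n ∧
      (∀ x ∈ s, w (f.eval x) < γ ^ f.natDegree) ∧
      ∀ x ∈ s, ∀ y ∈ s, x ≠ y → γ ≤ w (x - y) := by
    intro n
    induction n with
    | zero => exact ⟨∅, by simp⟩
    | succ n ih =>
      obtain ⟨s, hcard, hsf, hsep⟩ := ih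
      have hcompl : ⋂ x ∈ s, {y | w (y - x) < γ}ᶜ ∈ (U : Filter F) :=
        (Filter.biInter_finset_mem s).mpr fun x _ ↦ Ultrafilter.compl_mem_iff_notMem.mpr (hball x)
      obtain ⟨z, hzf, hz⟩ := Ultrafilter.nonempty_of_mem (Filter.inter_mem hU hcompl)
      have hz' : ∀ x ∈ s, γ ≤ w (z - x) := by simpa using hz
      have hzs : z ∉ s := fun hmem ↦ hγ (by simpa using hz' z hmem)
      refine ⟨insert z s, by rw [Finset.card_insert_of_notMem hzs, hcard], ?_, ?_⟩
      · intro x hx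
        obtain rfl | hx := Finset.mem_insert.mp hx
        exacts [hzf, hsf x hx]
      · intro x hx y hy hxy
        obtain rfl | hxs := Finset.mem_insert.mp hx <;>
          obtain rfl | hys := Finset.mem_insert.mp hy
        · exact absurd rfl hxy
        · exact hz' y hys
        · rw [w.map_sub_swap]
          exact hz' x hxs
        · exact hsep x hxs y hys hxy
  obtain ⟨s, hcard, hsf, hsep⟩ := hex (f.natDegree + 1)
  obtain ⟨x, hx, y, hy, hxy, hlt⟩ := w.exists_sub_lt_of_eval_lt hf hcard hγ hsf
  exact hlt.not_ge (hsep x hx y hy hxy)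

open Filter Topology in
/-- In a complete valued field, the set of values of a nonconstant monic polynomial is closed. -/
theorem Valued.isClosed_range_eval {F : Type*} {Γ : Type*} [Field F]
    [LinearOrderedCommGroupWithZero Γ] [Valued F Γ] [CompleteSpace F] {f : F[X]}
    (hf : f.Monic) (hdeg : f.natDegree ≠ 0) : IsClosed (Set.range fun x ↦ f.eval x) := by
  refine isClosed_of_closure_subset fun a ha ↦ ?_
  have : (comap (fun x ↦ f.eval x) (𝓝 a)).NeBot := by
    rw [comap_neBot_iff_frequently]
    exact mem_closure_iff_frequently.mp ha
  set U := Ultrafilter.of (comap (fun x ↦ f.eval x) (𝓝 a))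
  have hUa : Tendsto (fun x ↦ f.eval x) U (𝓝 a) := tendsto_iff_comap.mpr (Ultrafilter.of_le _)
  have hC : (C a).degree < f.degree :=
    degree_C_le.trans_lt (natDegree_pos_iff_degree_pos.mp (Nat.pos_of_ne_zero hdeg))
  have hcauchy : Cauchy (U : Filter F) := by
    refine Valued.cauchy_iff.mpr ⟨inferInstance, fun γ ↦ ?_⟩
    have hmem : {x | (Valued.v (R := F)).restrict ((f - C a).eval x) <
        γ.1 ^ (f - C a).natDegree} ∈ U := by
      have hnhds : {y | (Valued.v (R := F)).restrict (y - a) < γ.1 ^ (f - C a).natDegree} ∈ 𝓝 a :=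
        Valued.mem_nhds.mpr ⟨γ ^ (f - C a).natDegree, by simp⟩
      simpa using hUa hnhds
    obtain ⟨z, hz⟩ := (Valued.v (R := F)).restrict.exists_ball_mem_ultrafilter
      (hf.sub_of_left hC) U γ.ne_zero hmem
    refine ⟨_, hz, fun x hx y hy ↦ ?_⟩
    have := (Valued.v (R := F)).restrict.map_sub_lt hy hx
    rwa [sub_sub_sub_cancel_right] at this
  obtain ⟨x, hx⟩ := CompleteSpace.complete hcauchy
  exact ⟨x, tendsto_nhds_unique ((f.continuous.tendsto x).mono_left hx) hUa⟩

set_option synthInstance.maxHeartbeats 1000000 in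
/-- If `p` is prime and the multiplicative group of a valued field `(K, v)`
is `p`-divisible, then the multiplicative group of the completion of `(K, v)` is
`p`-divisible. -/
theorem completion_p_divisible {K : Type u} {Γ : Type v} [Field K]
    [LinearOrderedCommGroupWithZero Γ] [Valued K Γ] (p : ℕ) (hp : p.Prime)
    (h : ∀ a : K, a ≠ 0 → ∃ b : K, b ^ p = a) :
    ∀ a : UniformSpace.Completion K, a ≠ 0 →
      ∃ b : UniformSpace.Completion K, b ^ p = a := by
  intro a _
  have hclosed := Valued.isClosed_range_eval (F := UniformSpace.Completion K)
    (monic_X_pow p) (by simpa using hp.ne_zero)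
  obtain ⟨b, hb⟩ : a ∈ Set.range fun x : UniformSpace.Completion K ↦ (X ^ p : _[X]).eval x := by
    refine UniformSpace.Completion.induction_on a hclosed fun c ↦ ?_
    obtain ⟨b, hb⟩ : ∃ b : K, b ^ p = c := by
      obtain rfl | hc := eq_or_ne c 0
      exacts [⟨0, zero_pow hp.ne_zero⟩, h c hc]
    refine ⟨b, ?_⟩
    simp only [← hb, eval_pow, eval_X]
    exact (map_pow (UniformSpace.Completion.coeRingHom (α := K)) b p).symm
  exact ⟨b, by simpa using hb⟩
end

section
/- Suppose K is an immediately algebraically closed (IAC) field of characteristic zero such that the multiplicative group K^× is divisible, i.e. for every nonzero a ∈ K and every integer n ≥ 1 there exists b ∈ K with b^n = a. Then K is valuationally algebraically closed (VAC). -/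
open Polynomial

universe u v

section
variable {F E : Type*} [NontriviallyNormedField F] [CompleteSpace F] [NormedField E]
  [NormedAlgebra F E]

open IntermediateField in
theorem IntermediateField.norm_algHom_le {L : IntermediateField F E} [FiniteDimensional F L]
    (φ : L →ₐ[F] E) (z : L) : ‖φ z‖ ≤ ‖z‖ := by
  let ψ : L →L[F] E := ⟨φ.toLinearMap, LinearMap.continuous_of_finiteDimensional _⟩
  by_contra! h
  have hz : 0 < ‖z‖ := norm_pos_iff.2 fun h0 ↦ by simp [h0] at h
  obtain ⟨n, hn⟩ := pow_unbounded_of_one_lt ‖ψ‖ ((one_lt_div hz).2 h)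
  rw [div_pow, lt_div_iff₀ (pow_pos hz n), ← norm_pow, ← norm_pow, ← map_pow] at hn
  exact (ψ.le_opNorm (z ^ n)).not_gt hn

open IntermediateField in
theorem norm_sub_algebraMap_le_of_mem_aroots {x y : E} (hx : IsIntegral F x)
    (hy : y ∈ (minpoly F x).aroots E) (c : F) :
    ‖y - algebraMap F E c‖ ≤ ‖x - algebraMap F E c‖ := by
  have := adjoin.finiteDimensional hx
  let φ : F⟮x⟯ →ₐ[F] E := (adjoin.powerBasis hx).lift y (by
    rw [adjoin.powerBasis_gen, minpoly_gen]
    exact (mem_aroots'.1 hy).2)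
  have hφ : φ (AdjoinSimple.gen F x) = y := by
    rw [← adjoin.powerBasis_gen hx]; exact PowerBasis.lift_gen _ _ _
  have := norm_algHom_le φ (AdjoinSimple.gen F x - algebraMap F _ c)
  rwa [map_sub, hφ, AlgHom.commutes] at this

theorem Multiset.norm_sum_sub_le {E : Type*} [NormedField E] [IsUltrametricDist E]
    {s : Multiset E} {c : E} {C : ℝ} (hC : 0 ≤ C) (h : ∀ y ∈ s, ‖y - c‖ ≤ C) :
    ‖s.sum - s.card * c‖ ≤ C := by
  induction s using Multiset.induction_on with
  | empty => simpa
  | cons a s ih =>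
    have : (a ::ₘ s).sum - ((a ::ₘ s).card : E) * c = (a - c) + (s.sum - s.card * c) := by
      simp; ring
    rw [this]
    exact (IsUltrametricDist.norm_add_le_max _ _).trans (max_le (h a (Multiset.mem_cons_self a s))
      (ih fun y hy ↦ h y (Multiset.mem_cons_of_mem hy)))

theorem mem_range_algebraMap_of_norm_natDegree_minpoly_eq_one [IsUltrametricDist E]
    (himm : ∀ y : E, y ≠ 0 → ∃ c : F, ‖y - algebraMap F E c‖ < ‖y‖)
    {x : E} (hx : IsIntegral F x) (hs : ((minpoly F x).map (algebraMap F E)).Splits)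
    (hd : ‖((minpoly F x).natDegree : E)‖ = 1) : x ∈ Set.range (algebraMap F E) := by
  set d := (minpoly F x).natDegree with hd_def
  have hcard : (((minpoly F x).aroots E).card : E) = d := by
    rw [hd_def, ← natDegree_map (algebraMap F E), hs.natDegree_eq_card_roots]
  have hsum : ((minpoly F x).aroots E).sum = algebraMap F E (-(minpoly F x).nextCoeff) := by
    have := hs.nextCoeff_eq_neg_sum_roots_of_monic ((minpoly.monic hx).map _)
    rw [nextCoeff_map (algebraMap F E).injective] at this
    rw [map_neg, this, neg_neg]
  have hd0 : (d : E) ≠ 0 := norm_ne_zero_iff.1 (by simp [hd])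
  set e : F := -(minpoly F x).nextCoeff / d with he
  have hde : ((minpoly F x).aroots E).sum = d * algebraMap F E e := by
    rw [hsum, he, map_div₀, map_natCast, mul_div_cancel₀ _ hd0]
  have hbest : ∀ c : F, ‖algebraMap F E e - algebraMap F E c‖ ≤ ‖x - algebraMap F E c‖ := by
    intro c
    have := Multiset.norm_sum_sub_le (norm_nonneg _)
      (fun y hy ↦ norm_sub_algebraMap_le_of_mem_aroots hx hy c)
    rwa [hcard, hde, ← mul_sub, norm_mul, hd, one_mul] at this
  by_contra hxF
  obtain ⟨c, hc⟩ := himm (x - algebraMap F E e) fun h ↦ hxF ⟨e, (sub_eq_zero.1 h).symm⟩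
  have h1 := hbest (e + c)
  have h2 : x - algebraMap F E (e + c) = x - algebraMap F E e - algebraMap F E c := by
    rw [map_add]; ring
  rw [h2] at h1
  have h3 : ‖x - algebraMap F E e‖ ≤ max ‖x - algebraMap F E e - algebraMap F E c‖
      ‖algebraMap F E e - algebraMap F E (e + c)‖ := by
    have : x - algebraMap F E e = (x - algebraMap F E e - algebraMap F E c) +
      -(algebraMap F E e - algebraMap F E (e + c)) := by rw [map_add]; ring
    conv_lhs => rw [this]
    rw [← norm_neg (algebraMap F E e - _)]
    exact IsUltrametricDist.norm_add_le_max _ _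
  exact (h3.trans_lt (max_lt hc (h1.trans_lt hc))).false

theorem exists_prime_norm_natCast_eq_one [IsUltrametricDist E] [CharZero E] :
    (∀ n : ℕ, n ≠ 0 → ‖(n : E)‖ = 1) ∨
      ∃ p : ℕ, p.Prime ∧ ∀ n : ℕ, n.Coprime p → ‖(n : E)‖ = 1 := by
  by_cases h : ∃ p : ℕ, p.Prime ∧ ‖(p : E)‖ < 1
  · obtain ⟨p, hp, hlt⟩ := h
    refine .inr ⟨p, hp, fun n hn ↦ le_antisymm (IsUltrametricDist.norm_natCast_le_one E n) ?_⟩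
    by_contra! hlt'
    have hb := congrArg (fun k : ℤ ↦ (k : E)) (Nat.gcd_eq_gcd_ab n p)
    simp only [hn.gcd_eq_one] at hb
    push_cast at hb
    have h1 : ‖(1 : E)‖ < 1 := by
      rw [hb]
      refine (IsUltrametricDist.norm_add_le_max _ _).trans_lt (max_lt ?_ ?_) <;> rw [norm_mul]
      · exact mul_lt_one_of_nonneg_of_lt_one_left (norm_nonneg _) hlt'
          (IsUltrametricDist.norm_intCast_le_one E _)
      · exact mul_lt_one_of_nonneg_of_lt_one_left (norm_nonneg _) hlt
          (IsUltrametricDist.norm_intCast_le_one E _)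
    simp at h1
  · push Not at h
    refine .inl fun n hn ↦ ?_
    induction n using Nat.recOnMul with
    | zero => exact absurd rfl hn
    | one => simp
    | prime p hp => exact le_antisymm (IsUltrametricDist.norm_natCast_le_one E p) (h p hp)
    | mul a b ha hb =>
      rw [Nat.cast_mul, norm_mul, ha (left_ne_zero_of_mul hn), hb (right_ne_zero_of_mul hn),
        one_mul]

open IntermediateField in
theorem IsGalois.bot_eq_top_of_coprime_of_pow {F L : Type*} [Field F] [Field L] [Algebra F L]
    [FiniteDimensional F L] [IsGalois F L] {p : ℕ} (hp : p.Prime)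
    (hζ : (primitiveRoots p F).Nonempty)
    (htame : ∀ x : L, (minpoly F x).natDegree.Coprime p → x ∈ (⊥ : IntermediateField F L))
    (hrad : ∀ x : L, x ^ p ∈ (⊥ : IntermediateField F L) → x ∈ (⊥ : IntermediateField F L)) :
    (⊥ : IntermediateField F L) = ⊤ := by
  have : Fact p.Prime := ⟨hp⟩
  let P : Sylow p Gal(L/F) := default
  have hindex : ∀ H : Subgroup Gal(L/F), Module.finrank F (fixedField H) = H.index := fun H ↦ by
    rw [finrank_eq_fixingSubgroup_index, fixingSubgroup_fixedField]
  have hcop : (P : Subgroup Gal(L/F)).index.Coprime p :=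
    (hp.coprime_iff_not_dvd.2 P.not_dvd_index).symm
  have hM : fixedField (P : Subgroup Gal(L/F)) = ⊥ := by
    refine le_bot_iff.1 fun x hx ↦ htame x ?_
    have hdvd := minpoly.degree_dvd
      (IsIntegral.of_finite F (⟨x, hx⟩ : fixedField (P : Subgroup Gal(L/F))))
    rw [hindex, IntermediateField.minpoly_eq] at hdvd
    exact Nat.Coprime.of_dvd_left hdvd hcop
  have hcard : Nat.card Gal(L/F) = Nat.card P := by
    have hP : (P : Subgroup Gal(L/F)) = ⊤ := by
      rw [← fixingSubgroup_fixedField (P : Subgroup Gal(L/F)), hM, fixingSubgroup_bot]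
    rw [← Subgroup.card_top (G := Gal(L/F)), ← hP]
  obtain ⟨k, hk⟩ := (IsPGroup.iff_card.1 P.2)
  replace hcard := hcard.trans hk
  cases k with
  | zero =>
    rw [IsGalois.card_aut_eq_finrank, pow_zero] at hcard
    exact bot_eq_top_iff_finrank_eq_one.2 hcard
  | succ n =>
    obtain ⟨H, hH⟩ := Sylow.exists_subgroup_card_pow_prime (G := Gal(L/F)) p (n := n)
      (hcard ▸ pow_dvd_pow p n.le_succ)
    have hHi : H.index = p := by
      have := H.card_mul_index
      rw [hH, hcard, pow_succ] at this
      exact Nat.eq_of_mul_eq_mul_left (pow_pos hp.pos n) this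
    have : H.Normal := Subgroup.normal_of_index_eq_minFac_card
      (by rw [hHi, hcard, hp.pow_minFac n.succ_ne_zero])
    have hrank : Module.finrank F (fixedField H) = p := (hindex H).trans hHi
    have : IsGalois F (fixedField H) := IsGalois.of_fixedField_normal_subgroup H
    have : IsCyclic Gal(fixedField H/F) :=
      isCyclic_of_prime_card (p := p) (by rw [IsGalois.card_aut_eq_finrank, hrank])
    obtain ⟨α, ⟨a, ha⟩, hα⟩ := exists_root_adjoin_eq_top_of_isCyclic F (fixedField H)
      (hrank.symm ▸ hζ)
    rw [hrank] at ha
    obtain ⟨b, hb⟩ := mem_bot.1 (hrad (α : L) (mem_bot.2 ⟨a, congrArg Subtype.val ha⟩))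
    have hα' : α ∈ (⊥ : IntermediateField F (fixedField H)) := mem_bot.2 ⟨b, Subtype.ext hb⟩
    rw [← adjoin_simple_eq_bot_iff, hα] at hα'
    have := finrank_top' (F := F) (E := fixedField H)
    rw [hα', IntermediateField.finrank_bot, hrank] at this
    exact absurd this.symm hp.one_lt.ne'

open IntermediateField in
theorem mem_range_algebraMap_of_splits [IsUltrametricDist E] [CharZero F]
    (himm : ∀ y : E, y ≠ 0 → ∃ c : F, ‖y - algebraMap F E c‖ < ‖y‖)
    (hζ : ∀ p : ℕ, p.Prime → ∃ ζ : E, IsPrimitiveRoot ζ p)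
    (hrad : ∀ p : ℕ, p.Prime → (primitiveRoots p F).Nonempty → ∀ x : E,
      x ^ p ∈ Set.range (algebraMap F E) → x ∈ Set.range (algebraMap F E))
    {x : E} (hx : IsIntegral F x) (hs : ((minpoly F x).map (algebraMap F E)).Splits) :
    x ∈ Set.range (algebraMap F E) := by
  have : CharZero E := charZero_of_injective_algebraMap (algebraMap F E).injective
  obtain h | ⟨p, hp, h⟩ := exists_prime_norm_natCast_eq_one (E := E)
  · exact mem_range_algebraMap_of_norm_natDegree_minpoly_eq_one himm hx hs
      (h _ (minpoly.natDegree_pos hx).ne')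
  let L : IntermediateField F E := adjoin F ((minpoly F x).rootSet E)
  have : IsSplittingField F L (minpoly F x) := adjoin_rootSet_isSplittingField hs
  have : FiniteDimensional F L := IsSplittingField.finiteDimensional L (minpoly F x)
  have : IsGalois F L := IsGalois.of_separable_splitting_field (minpoly.irreducible hx).separable
  have hmem : ∀ z : L, (z : E) ∈ Set.range (algebraMap F E) → z ∈ (⊥ : IntermediateField F L) :=
    fun z ⟨c, hc⟩ ↦ mem_bot.2 ⟨c, Subtype.ext hc⟩
  have hζF : (primitiveRoots p F).Nonempty := by
    obtain ⟨ζ, hζ⟩ := hζ p hp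
    have hev : aeval ζ (cyclotomic p F) = 0 := by
      have := hζ.isRoot_cyclotomic hp.pos
      rwa [← map_cyclotomic p (algebraMap F E), IsRoot, eval_map_algebraMap] at this
    have hint : IsIntegral F ζ := ⟨_, cyclotomic.monic p F, hev⟩
    have hdvd : minpoly F ζ ∣ cyclotomic p F := minpoly.dvd F ζ hev
    have hspl : ((cyclotomic p F).map (algebraMap F E)).Splits := by
      rw [map_cyclotomic]
      exact (X_pow_sub_one_splits hζ).of_dvd (X_pow_sub_C_ne_zero hp.pos 1)
        (by simpa using cyclotomic.dvd_X_pow_sub_one p E)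
    obtain ⟨c, hc⟩ := mem_range_algebraMap_of_norm_natDegree_minpoly_eq_one himm hint
      (hspl.of_dvd ((cyclotomic.monic p F).map _).ne_zero (Polynomial.map_dvd _ hdvd)) (h _ (by
        refine (Nat.coprime_of_lt_prime (minpoly.natDegree_pos hint).ne' ?_ hp).symm
        have := natDegree_le_of_dvd hdvd (cyclotomic_ne_zero p F)
        rw [natDegree_cyclotomic, Nat.totient_prime hp] at this
        have := hp.pos
        lia))
    refine ⟨c, (mem_primitiveRoots hp.pos).2 (.of_map_of_injective (f := algebraMap F E) ?_
      (algebraMap F E).injective)⟩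
    rwa [hc]
  have htop := IsGalois.bot_eq_top_of_coprime_of_pow (L := L) hp hζF
    (fun z hz ↦ hmem z ?_) (fun z hz ↦ hmem z ?_)
  · have hxL : x ∈ L := subset_adjoin F _ (by
      rw [mem_rootSet]; exact ⟨minpoly.ne_zero hx, minpoly.aeval F x⟩)
    have : (⟨x, hxL⟩ : L) ∈ (⊥ : IntermediateField F L) := htop ▸ mem_top
    obtain ⟨c, hc⟩ := mem_bot.1 this
    exact ⟨c, congrArg Subtype.val hc⟩
  · rw [minpoly_eq] at hz
    refine mem_range_algebraMap_of_norm_natDegree_minpoly_eq_one himm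
      (isAlgebraic_iff.1 (IsIntegral.of_finite F z).isAlgebraic).isIntegral ?_ (h _ hz)
    have := (Normal.splits (F := F) (K := L) inferInstance z).map (algebraMap L E)
    rwa [Polynomial.map_map, ← IsScalarTower.algebraMap_eq, minpoly_eq] at this
  · obtain ⟨c, hc⟩ := mem_bot.1 hz
    exact hrad p hp hζF z ⟨c, congrArg Subtype.val hc⟩
end

theorem norm_eq_of_norm_sub_lt {E : Type*} [NormedField E] [IsUltrametricDist E] {x y : E}
    (h : ‖x - y‖ < ‖x‖) : ‖y‖ = ‖x‖ := by
  have := IsUltrametricDist.norm_add_eq_max_of_norm_ne_norm (x := -(x - y)) (y := x)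
    (by rw [norm_neg]; exact h.ne)
  rwa [norm_neg, max_eq_right h.le, neg_sub, sub_add_cancel] at this

theorem IsPrimitiveRoot.exists_norm_sub_mul_lt {E : Type*} [NormedField E] {p : ℕ} {ζ : E}
    (hζ : IsPrimitiveRoot ζ p) (hp : 0 < p) {x b : E} {ε : ℝ} (hε : 0 < ε)
    (h : ‖x ^ p - b ^ p‖ < ε ^ p) : ∃ i : ℕ, ‖x - ζ ^ i * b‖ < ε := by
  by_contra! hcon
  have : NeZero p := ⟨hp.ne'⟩
  rw [hζ.pow_sub_pow_eq_prod_sub_mul _ _ hp, norm_prod] at h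
  have hcard : ε ^ p = ∏ _η ∈ nthRootsFinset p (1 : E), ε := by
    rw [Finset.prod_const, hζ.card_nthRootsFinset]
  rw [hcard] at h
  refine h.not_ge (Finset.prod_le_prod (fun _ _ ↦ hε.le) fun η hη ↦ ?_)
  obtain ⟨i, -, rfl⟩ := hζ.eq_pow_of_pow_eq_one ((Polynomial.mem_nthRootsFinset hp 1).1 hη)
  exact hcon i

theorem exists_norm_sub_algebraMap_lt_of_divisible {K A : Type*} [Field K] [NormedField A]
    [IsUltrametricDist A] [Algebra K A] [CharZero K] [IsAlgClosed A] [Algebra.IsIntegral K A]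
    (hA : ∃ y : A, y ≠ 0 ∧ ‖y‖ ≠ 1)
    (himm : ∀ y : A, y ≠ 0 → ∃ c : K, ‖y - algebraMap K A c‖ < ‖y‖)
    (hdiv : ∀ a : K, a ≠ 0 → ∀ n : ℕ, 1 ≤ n → ∃ b : K, b ^ n = a)
    (a : A) {ε : ℝ} (hε : 0 < ε) : ∃ b : K, ‖a - algebraMap K A b‖ < ε := by
  let E := UniformSpace.Completion A
  let ι : A →+* E := UniformSpace.Completion.coeRingHom
  have hι : ∀ z : A, ‖ι z‖ = ‖z‖ := UniformSpace.Completion.norm_coe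
  have : IsUltrametricDist E := by
    refine IsUltrametricDist.isUltrametricDist_of_forall_norm_add_le_max_norm fun x y ↦ ?_
    induction x, y using UniformSpace.Completion.induction_on₂ with
    | hp => exact isClosed_le (by fun_prop) (by fun_prop)
    | ih x y =>
      rw [← UniformSpace.Completion.coe_add, UniformSpace.Completion.norm_coe,
        UniformSpace.Completion.norm_coe, UniformSpace.Completion.norm_coe]
      exact IsUltrametricDist.norm_add_le_max x y
  have hdense : ∀ (y : E) {δ : ℝ}, 0 < δ → ∃ z : A, ‖y - ι z‖ < δ := fun y δ hδ ↦ by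
    obtain ⟨z, hz⟩ := UniformSpace.Completion.denseRange_coe.exists_dist_lt y hδ
    exact ⟨z, by rwa [dist_eq_norm] at hz⟩
  let F₀ : Subfield E := (ι.comp (algebraMap K A)).fieldRange
  let F : Subfield E := F₀.topologicalClosure
  have hFclosed : IsClosed (F : Set E) := F₀.isClosed_topologicalClosure
  have hKF : ∀ c : K, ι (algebraMap K A c) ∈ F := fun c ↦
    F₀.le_topologicalClosure ⟨c, rfl⟩
  have hFK : ∀ y ∈ F, ∀ {δ : ℝ}, 0 < δ → ∃ c : K, ‖y - ι (algebraMap K A c)‖ < δ := by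
    intro y hy δ hδ
    obtain ⟨_, ⟨c, rfl⟩, hc⟩ := Metric.mem_closure_iff.1 hy δ hδ
    exact ⟨c, by rwa [dist_eq_norm] at hc⟩
  let j : K →+* F := (ι.comp (algebraMap K A)).codRestrict F hKF
  have : CharZero F := charZero_of_injective_ringHom j.injective
  have : CompleteSpace F := hFclosed.completeSpace_coe
  let : NontriviallyNormedField F :=
    { SubfieldClass.toNormedField F with
      non_trivial := by
        obtain ⟨y, hy0, hy1⟩ := hA
        obtain ⟨z, hz⟩ : ∃ z : A, 1 < ‖z‖ ∧ z ≠ 0 := by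
          obtain h | h := hy1.lt_or_gt
          · exact ⟨y⁻¹, by rw [norm_inv]; exact (one_lt_inv₀ (norm_pos_iff.2 hy0)).2 h,
              inv_ne_zero hy0⟩
          · exact ⟨y, h, hy0⟩
        obtain ⟨c, hc⟩ := himm z hz.2
        refine ⟨j c, ?_⟩
        change 1 < ‖ι (algebraMap K A c)‖
        rw [hι, norm_eq_of_norm_sub_lt hc]
        exact hz.1 }
  let : NormedAlgebra F E :=
    { (inferInstance : Algebra F E) with
      norm_smul_le := fun r x ↦ (norm_mul (r : E) x).le }
  have hrange : ∀ y : E, y ∈ Set.range (algebraMap F E) ↔ y ∈ F := fun y ↦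
    ⟨fun ⟨c, hc⟩ ↦ hc ▸ c.2, fun h ↦ ⟨⟨y, h⟩, rfl⟩⟩
  have hcomp : (algebraMap F E).comp j = ι.comp (algebraMap K A) := rfl
  have hmin : minpoly F (ι a) ∣ (minpoly K a).map j := minpoly.dvd _ _ (by
    rw [aeval_def, eval₂_map, hcomp, ← hom_eval₂, ← aeval_def, minpoly.aeval, map_zero])
  have hmonic := minpoly.monic (Algebra.IsIntegral.isIntegral (R := K) a)
  have hint : IsIntegral F (ι a) := ⟨(minpoly K a).map j, hmonic.map j, by
    rw [eval₂_map, hcomp, ← hom_eval₂, ← aeval_def, minpoly.aeval, map_zero]⟩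
  have hmem : ι a ∈ F := by
    refine (hrange _).1 (mem_range_algebraMap_of_splits ?_ ?_ ?_ hint ?_)
    · intro y hy
      obtain ⟨z, hz⟩ := hdense y (norm_pos_iff.2 hy)
      have hzy := norm_eq_of_norm_sub_lt hz
      rw [hι] at hzy
      obtain ⟨c, hc⟩ := himm z (norm_ne_zero_iff.1 (hzy ▸ norm_ne_zero_iff.2 hy))
      refine ⟨j c, ?_⟩
      have hsplit : y - algebraMap F E (j c) = (y - ι z) + ι (z - algebraMap K A c) := by
        rw [map_sub]; exact (sub_add_sub_cancel _ _ _).symm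
      rw [hsplit]
      refine (IsUltrametricDist.norm_add_le_max _ _).trans_lt (max_lt hz ?_)
      rwa [hι, ← hzy]
    · intro p hp
      have : CharZero A := charZero_of_injective_algebraMap (algebraMap K A).injective
      have : NeZero (p : A) := ⟨Nat.cast_ne_zero.2 hp.ne_zero⟩
      obtain ⟨ζ, hζ⟩ := IsAlgClosed.exists_root (cyclotomic p A)
        (degree_cyclotomic_pos p A hp.pos).ne'
      exact ⟨ι ζ, (isRoot_cyclotomic_iff.1 hζ).map_of_injective ι.injective⟩
    · rintro p hp ⟨ζ, hζ⟩ x hx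
      rw [hrange] at hx ⊢
      replace hζ := ((mem_primitiveRoots hp.pos).1 hζ).map_of_injective (algebraMap F E).injective
      rw [← SetLike.mem_coe, ← hFclosed.closure_eq]
      refine Metric.mem_closure_iff.2 fun δ hδ ↦ ?_
      obtain ⟨c, hc⟩ := hFK _ hx (pow_pos hδ p)
      obtain ⟨b, hb⟩ : ∃ b : K, b ^ p = c := by
        obtain rfl | h0 := eq_or_ne c 0
        · exact ⟨0, zero_pow hp.ne_zero⟩
        · exact hdiv c h0 p hp.one_le
      rw [← hb, map_pow, map_pow] at hc
      obtain ⟨i, hi⟩ := hζ.exists_norm_sub_mul_lt hp.pos hδ hc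
      exact ⟨_, F.mul_mem (F.pow_mem ζ.2 i) (hKF b), by rwa [dist_eq_norm]⟩
    · refine Splits.of_dvd (g := ((minpoly K a).map j).map (algebraMap F E)) ?_
        ((hmonic.map j).map _).ne_zero (Polynomial.map_dvd _ hmin)
      rw [Polynomial.map_map, hcomp, ← Polynomial.map_map]
      exact (IsAlgClosed.splits _).map ι
  obtain ⟨b, hb⟩ := hFK _ hmem hε
  exact ⟨b, by rwa [← map_sub, hι] at hb⟩

section
variable {K A Γ : Type*} [Field K] [Field A] [Algebra K A] [LinearOrderedCommGroupWithZero Γ]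

theorem Valuation.exists_pow_eq_map_algebraMap_of_isAlgebraic (w : Valuation A Γ) {y : A}
    (hy : IsAlgebraic K y) (hy0 : y ≠ 0) :
    ∃ n : ℕ, 1 ≤ n ∧ ∃ a : K, a ≠ 0 ∧ w y ^ n = w (algebraMap K A a) := by
  classical
  obtain ⟨f, hf0, hf⟩ := hy
  have hwy : w y ≠ 0 := w.ne_zero_iff.2 hy0
  let t : ℕ → A := fun i ↦ algebraMap K A (f.coeff i) * y ^ i
  have ht : ∑ i ∈ f.support, t i = 0 := by
    rw [← hf, aeval_eq_sum_range, ← Finset.sum_subset f.supp_subset_range_natDegree_succ]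
    · simp [t, Algebra.smul_def]
    · intro i _ hi
      simp [notMem_support_iff.1 hi]
  have hc : ∀ i ∈ f.support, w (algebraMap K A (f.coeff i)) ≠ 0 := fun i hi ↦
    w.ne_zero_iff.2 ((_root_.map_ne_zero _).2 (mem_support_iff.1 hi))
  obtain ⟨i, hi, himax⟩ := f.support.exists_max_image (fun i ↦ w (t i)) (nonempty_support_iff.2 hf0)
  obtain ⟨k, hk, hki, hkeq⟩ : ∃ k ∈ f.support, k ≠ i ∧ w (t k) = w (t i) := by
    by_contra! hcon
    have := w.map_sum_eq_of_lt hi fun k hk ↦ by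
      obtain ⟨hk, hki⟩ := Finset.mem_sdiff.1 hk
      exact (himax k hk).lt_of_ne (hcon k hk (by simpa using hki))
    rw [ht, map_zero, map_mul, map_pow] at this
    exact mul_ne_zero (hc i hi) (pow_ne_zero i hwy) this.symm
  have key : ∀ m n : ℕ, m ∈ f.support → n ∈ f.support → m < n → w (t m) = w (t n) →
      ∃ n : ℕ, 1 ≤ n ∧ ∃ a : K, a ≠ 0 ∧ w y ^ n = w (algebraMap K A a) := by
    intro m n hm hn hmn heq
    refine ⟨n - m, by lia, f.coeff m / f.coeff n,
      div_ne_zero (mem_support_iff.1 hm) (mem_support_iff.1 hn), ?_⟩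
    rw [map_div₀, map_div₀, eq_div_iff (hc n hn)]
    simp only [t, map_mul, map_pow] at heq
    apply mul_right_cancel₀ (pow_ne_zero m hwy)
    rw [heq, mul_right_comm, ← pow_add, Nat.sub_add_cancel hmn.le, mul_comm]
  obtain h | h := hki.lt_or_gt
  · exact key k i hk hi h hkeq
  · exact key i k hi hk h hkeq.symm

theorem Valuation.exists_sub_algebraMap_lt_one (w : Valuation A Γ)
    (hres : HasAlgClosedResidueField (w.comap (algebraMap K A))) {y : A}
    (hy : IsAlgebraic K y) (hwy : w y ≤ 1) : ∃ c : K, w (y - algebraMap K A c) < 1 := by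
  let v := w.comap (algebraMap K A)
  have : IsAlgClosed (IsLocalRing.ResidueField v.valuationSubring) := hres
  have : v.HasExtension w := ⟨Valuation.IsEquiv.refl⟩
  obtain ⟨f, hf0, hf⟩ := hy
  obtain ⟨i, hi, himax⟩ := f.support.exists_max_image (fun i ↦ v (f.coeff i))
    (nonempty_support_iff.2 hf0)
  have hi0 := mem_support_iff.1 hi
  obtain ⟨g, hg⟩ := (mem_lifts (C (f.coeff i)⁻¹ * f)).1
    ((lifts_iff_coeff_lifts (f := algebraMap v.valuationSubring K) _).2 fun n ↦ by
      refine ⟨⟨(C (f.coeff i)⁻¹ * f).coeff n, ?_⟩, rfl⟩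
      rw [coeff_C_mul, Valuation.mem_valuationSubring_iff, map_mul, map_inv₀,
        inv_mul_le_one₀ (zero_lt_iff.2 (v.ne_zero_iff.2 hi0))]
      by_cases hn : n ∈ f.support
      · exact himax n hn
      · simp [notMem_support_iff.1 hn])
  have hg0 : g.map (IsLocalRing.residue v.valuationSubring) ≠ 0 := fun h0 ↦ by
    have h1 : g.coeff i = 1 := by
      apply Subtype.ext
      have := congrArg (fun q ↦ q.coeff i) hg
      simp only [coeff_map, coeff_C_mul, inv_mul_cancel₀ hi0] at this
      exact this
    have := congrArg (fun q ↦ q.coeff i) h0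
    simp [h1] at this
  let y₀ : w.valuationSubring := ⟨y, hwy⟩
  have hgy : eval₂ (algebraMap v.valuationSubring w.valuationSubring) y₀ g = 0 := by
    apply Subtype.ext
    have := hom_eval₂ g (algebraMap v.valuationSubring w.valuationSubring)
      w.valuationSubring.subtype y₀
    refine this.trans ?_
    change eval₂ ((algebraMap K A).comp (algebraMap v.valuationSubring K)) y g = 0
    rw [← eval₂_map, hg, ← aeval_def, map_mul, hf, mul_zero]
  obtain ⟨c, hc⟩ := (IsAlgClosed.splits
    (g.map (IsLocalRing.residue v.valuationSubring))).mem_range_of_isRoot hg0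
    (i := algebraMap _ (IsLocalRing.ResidueField w.valuationSubring))
    (x := IsLocalRing.residue _ y₀) (by
      rw [IsRoot, eval_map, eval₂_map]
      change eval₂ ((IsLocalRing.residue w.valuationSubring).comp
        (algebraMap v.valuationSubring w.valuationSubring)) _ g = 0
      rw [← hom_eval₂, hgy, map_zero])
  obtain ⟨c, rfl⟩ := IsLocalRing.residue_surjective c
  refine ⟨c, ?_⟩
  have hmem : y₀ - algebraMap v.valuationSubring w.valuationSubring c ∈
      IsLocalRing.maximalIdeal w.valuationSubring := by
    rw [← IsLocalRing.residue_eq_zero_iff, _root_.map_sub, ← hc, sub_eq_zero]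
    rfl
  exact w.mem_maximalIdeal_iff.1 hmem

end

theorem IsIAC.exists_sub_algebraMap_lt {K A Γ : Type u} [Field K] [Field A] [Algebra K A]
    [Algebra.IsAlgebraic K A] [LinearOrderedCommGroupWithZero Γ] (hK : IsIAC K)
    {w : Valuation A Γ} (hw : IsNontrivialValuation w) {y : A} (hy : y ≠ 0) :
    ∃ c : K, w (y - algebraMap K A c) < w y := by
  obtain ⟨hres, hval⟩ := hK Γ _ (w.comap (algebraMap K A)) (by
    obtain ⟨x, hx0, hx1⟩ := hw
    obtain ⟨n, hn, a, ha0, ha⟩ :=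
      w.exists_pow_eq_map_algebraMap_of_isAlgebraic (Algebra.IsAlgebraic.isAlgebraic (R := K) x) hx0
    refine ⟨a, ha0, fun h1 ↦ hx1 ?_⟩
    rw [Valuation.comap_apply, ← ha] at h1
    exact (pow_eq_one_iff_of_nonneg zero_le (by lia)).1 h1)
  obtain ⟨n, hn, a, ha0, ha⟩ :=
    w.exists_pow_eq_map_algebraMap_of_isAlgebraic (Algebra.IsAlgebraic.isAlgebraic (R := K) y) hy
  obtain ⟨b, hb0, hb⟩ := hval a ha0 n hn
  rw [Valuation.comap_apply, Valuation.comap_apply, ← ha] at hb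
  replace hb : w (algebraMap K A b) = w y := (pow_left_inj₀ zero_le zero_le (by lia)).1 hb
  have hb0' : algebraMap K A b ≠ 0 := (_root_.map_ne_zero _).2 hb0
  have hwy : 0 < w y := zero_lt_iff.2 (w.ne_zero_iff.2 hy)
  obtain ⟨c, hc⟩ := w.exists_sub_algebraMap_lt_one hres
    (Algebra.IsAlgebraic.isAlgebraic (R := K) (y / algebraMap K A b))
    (by rw [map_div₀, hb, div_self hwy.ne'])
  refine ⟨b * c, ?_⟩
  have : y - algebraMap K A (b * c) =
      algebraMap K A b * (y / algebraMap K A b - algebraMap K A c) := by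
    rw [mul_sub, mul_div_cancel₀ _ hb0', map_mul]
  rw [this, map_mul, hb]
  exact mul_lt_of_lt_one_right hwy hc

section
variable {L Γ : Type*} [Field L] [LinearOrderedCommGroupWithZero Γ]

/-- The smallest coarsening of `w` whose valuation ring contains `g`. -/
def Valuation.coarseningContaining (w : Valuation L Γ) (g : L) (hg : 1 ≤ w g) :
    ValuationSubring L where
  carrier := {x | ∃ n : ℕ, w x ≤ w g ^ n}
  mul_mem' := by
    rintro x y ⟨m, hm⟩ ⟨n, hn⟩
    exact ⟨m + n, by rw [map_mul, pow_add]; exact mul_le_mul' hm hn⟩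
  one_mem' := ⟨0, by simp⟩
  add_mem' := by
    rintro x y ⟨m, hm⟩ ⟨n, hn⟩
    exact ⟨max m n, (w.map_add x y).trans (max_le
      (hm.trans (pow_le_pow_right₀ hg (le_max_left m n)))
      (hn.trans (pow_le_pow_right₀ hg (le_max_right m n))))⟩
  zero_mem' := ⟨0, by simp⟩
  neg_mem' := fun ⟨n, hn⟩ ↦ ⟨n, by rwa [w.map_neg]⟩
  mem_or_inv_mem' := fun x ↦ by
    refine (le_total (w x) 1).imp (fun h ↦ ⟨0, by simpa using h⟩) fun h ↦ ⟨0, ?_⟩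
    rw [map_inv₀, pow_zero]
    exact inv_le_one_of_one_le₀ h

/-- The largest coarsening of `w` whose valuation ring does not contain `g`, for `1 < w g`. -/
def Valuation.coarseningOmitting (w : Valuation L Γ) (g : L) (hg : 1 ≤ w g) :
    ValuationSubring L where
  carrier := {x | ∀ n : ℕ, w x ^ n ≤ w g}
  mul_mem' := by
    intro x y hx hy n
    rw [map_mul]
    obtain h | h := le_total (w x) (w y)
    · refine (pow_le_pow_left' (mul_le_mul_left h (w y)) n).trans ?_
      rw [← sq, ← pow_mul]
      exact hy _
    · refine (pow_le_pow_left' (mul_le_mul_right h (w x)) n).trans ?_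
      rw [← sq, ← pow_mul]
      exact hx _
  one_mem' := fun n ↦ by simpa using hg
  add_mem' := fun {x y} hx hy n ↦ by
    obtain h | h := le_max_iff.1 (w.map_add x y)
    · exact (pow_le_pow_left' h n).trans (hx n)
    · exact (pow_le_pow_left' h n).trans (hy n)
  zero_mem' := fun n ↦ by
    rw [map_zero]
    exact (pow_le_one' zero_le_one n).trans hg
  neg_mem' := fun hx n ↦ by rw [w.map_neg]; exact hx n
  mem_or_inv_mem' := fun x ↦ by
    refine (le_total (w x) 1).imp (fun h n ↦ (pow_le_one' h n).trans hg) fun h n ↦ ?_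
    rw [map_inv₀]
    exact (pow_le_one' (inv_le_one_of_one_le₀ h) n).trans hg

theorem Valuation.lt_of_valuation_lt_of_le {w : Valuation L Γ} {B : ValuationSubring L}
    (hB : w.valuationSubring ≤ B) {x y : L} (h : B.valuation x < B.valuation y) :
    w x < w y := by
  by_contra! hle
  refine h.not_ge ?_
  obtain rfl | hx := eq_or_ne x 0
  · obtain rfl : y = 0 := by simpa using hle
    exact le_rfl
  · have : y / x ∈ B := hB (by
      rw [Valuation.mem_valuationSubring_iff, map_div₀]
      exact div_le_one_of_le₀ hle zero_le)
    rw [← B.valuation_le_one_iff, map_div₀,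
      div_le_one₀ (zero_lt_iff.2 (B.valuation.ne_zero_iff.2 hx))] at this
    exact this

theorem ValuationSubring.isNontrivialValuation {B : ValuationSubring L} {g : L} (hg : g ∉ B) :
    IsNontrivialValuation B.valuation :=
  ⟨g, fun h ↦ hg (h ▸ B.zero_mem), fun h ↦ hg ((B.valuation_le_one_iff g).1 h.le)⟩

theorem Valuation.nonempty_rankOne_coarseningOmitting {w : Valuation L Γ} {g : L} (hg : 1 < w g)
    (hcof : ∀ x, ∃ n : ℕ, w x ≤ w g ^ n) :
    Nonempty (w.coarseningOmitting g hg.le).valuation.RankOne := by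
  set B := w.coarseningOmitting g hg.le with hB_def
  have hB : w.valuationSubring ≤ B := fun x hx n ↦
    (pow_le_one' ((w.mem_valuationSubring_iff x).1 hx) n).trans hg.le
  have hgB : g ∉ B := fun h ↦ (lt_self_pow₀ hg one_lt_two).not_ge (h 2)
  have : B.valuation.IsNontrivial := by
    obtain ⟨x, hx0, hx1⟩ := ValuationSubring.isNontrivialValuation hgB
    exact ⟨⟨x, B.valuation.ne_zero_iff.2 hx0, hx1⟩⟩
  have : MulArchimedean B.ValueGroup := ⟨fun x y hy ↦ by
    obtain ⟨x, rfl⟩ := B.valuation_surjective x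
    obtain ⟨y, rfl⟩ := B.valuation_surjective y
    have hyB : y ∉ B := fun h ↦ hy.not_ge ((B.valuation_le_one_iff y).2 h)
    obtain ⟨n, hn⟩ : ∃ n : ℕ, w g < w y ^ n := by
      by_contra! h
      exact hyB h
    obtain ⟨m, hm⟩ := hcof x
    refine ⟨n * m, ?_⟩
    by_contra! h
    rw [← map_pow] at h
    refine (lt_of_valuation_lt_of_le hB h).not_ge ?_
    rw [map_pow, pow_mul]
    exact hm.trans (pow_le_pow_left' hn.le m)⟩
  rw [Valuation.nonempty_rankOne_iff_mulArchimedean]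
  exact MulArchimedean.comap
    (MonoidWithZeroHom.ValueGroup₀.embedding (f := .ofClass B.valuation)).toMonoidHom
    MonoidWithZeroHom.ValueGroup₀.embedding_strictMono

theorem Valuation.RankOne.denseInWrt {K A Γ : Type*} [Field K] [Field A] [Algebra K A]
    [LinearOrderedCommGroupWithZero Γ] [CharZero K] [IsAlgClosed A] [Algebra.IsIntegral K A]
    {w : Valuation A Γ} (hw : w.RankOne)
    (himm : ∀ y : A, y ≠ 0 → ∃ c : K, w (y - algebraMap K A c) < w y)
    (hdiv : ∀ a : K, a ≠ 0 → ∀ n : ℕ, 1 ≤ n → ∃ b : K, b ^ n = a) :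
    DenseInWrt (algebraMap K A) w := by
  have hlt : ∀ x y : A, w.norm x < w.norm y ↔ w x < w y := fun x y ↦ by
    rw [norm_def, norm_def, NNReal.coe_lt_coe, (RankOne.strictMono w).lt_iff_lt, restrict_lt_iff]
  have hzero : w.norm 0 = 0 := by simp [norm_def]
  have hone : w.norm 1 = 1 := by simp [norm_def]
  let N : AbsoluteValue A ℝ :=
    { toFun := w.norm
      map_mul' := fun x y ↦ by simp [norm_def]
      nonneg' := w.norm_nonneg
      eq_zero' := fun x ↦ ⟨w.norm_eq_zero, fun h ↦ h ▸ hzero⟩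
      add_le' := fun x y ↦ (w.norm_add_le x y).trans
        (max_le_add_of_nonneg (w.norm_nonneg x) (w.norm_nonneg y)) }
  let : NormedField A := N.toNormedField
  have : IsUltrametricDist A :=
    IsUltrametricDist.isUltrametricDist_of_forall_norm_add_le_max_norm w.norm_add_le
  intro a c hc
  obtain ⟨b, hb⟩ := exists_norm_sub_algebraMap_lt_of_divisible (K := K) (A := A) (by
      obtain ⟨y, hy0, hy1⟩ := RankOne.nontrivial w
      refine ⟨y, w.ne_zero_iff.1 hy0, fun h ↦ hy1 ?_⟩
      have h' : w.norm y = w.norm 1 := h.trans hone.symm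
      have h1 := mt (hlt y 1).2 h'.not_lt
      have h2 := mt (hlt 1 y).2 h'.not_gt
      rw [map_one] at h1 h2
      exact le_antisymm (not_lt.1 h2) (not_lt.1 h1))
    (fun y hy ↦ (himm y hy).imp fun c hc ↦ (hlt _ _).2 hc) hdiv a (norm_pos_iff.2 hc)
  exact ⟨b, (hlt _ _).1 hb⟩

theorem Valuation.exists_one_lt_of_le {w : Valuation L Γ} (hw : IsNontrivialValuation w)
    (a b : L) : ∃ g : L, 1 < w g ∧ w a ≤ w g ∧ w b ≤ w g := by
  obtain ⟨g, hg⟩ : ∃ g : L, 1 < w g := by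
    obtain ⟨x, hx0, hx1⟩ := hw
    obtain h | h := hx1.lt_or_gt
    · exact ⟨x⁻¹, by rw [map_inv₀]; exact (one_lt_inv₀ (zero_lt_iff.2 (w.ne_zero_iff.2 hx0))).2 h⟩
    · exact ⟨x, h⟩
  have hmax : ∀ x y : L, ∃ z, w x ≤ w z ∧ w y ≤ w z := fun x y ↦
    (le_total (w x) (w y)).elim (fun h ↦ ⟨y, h, le_rfl⟩) fun h ↦ ⟨x, le_rfl, h⟩
  obtain ⟨d, had, hbd⟩ := hmax a b
  obtain ⟨e, hde, hge⟩ := hmax d g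
  exact ⟨e, hg.trans_le hge, had.trans hde, hbd.trans hde⟩

end

/-- An IAC field of characteristic zero whose multiplicative group is
divisible (every nonzero `a ∈ K` has an `n`-th root for every `n ≥ 1`) is VAC. -/
theorem isVAC_of_isIAC_divisible_units {K : Type u} [Field K] [CharZero K]
    (hIAC : IsIAC K) (hdiv : ∀ a : K, a ≠ 0 → ∀ n : ℕ, 1 ≤ n → ∃ b : K, b ^ n = a) :
    IsVAC K := by
  intro Γ _ w hw a c hc
  by_cases hcof : ∃ g, 1 < w g ∧ ∀ x, ∃ n : ℕ, w x ≤ w g ^ n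
  · obtain ⟨g, hg, hcof⟩ := hcof
    obtain ⟨hrk⟩ := Valuation.nonempty_rankOne_coarseningOmitting hg hcof
    have hnt : IsNontrivialValuation (w.coarseningOmitting g hg.le).valuation := by
      obtain ⟨x, hx0, hx1⟩ := hrk.nontrivial
      exact ⟨x, (Valuation.ne_zero_iff _).1 hx0, hx1⟩
    obtain ⟨b, hb⟩ := hrk.denseInWrt (fun y hy ↦ hIAC.exists_sub_algebraMap_lt hnt hy) hdiv a c hc
    have hB : w.valuationSubring ≤ w.coarseningOmitting g hg.le := fun x hx n ↦
      (pow_le_one' ((w.mem_valuationSubring_iff x).1 hx) n).trans hg.le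
    exact ⟨b, Valuation.lt_of_valuation_lt_of_le hB hb⟩
  · push Not at hcof
    obtain ⟨g, hg, hag, hcg⟩ := Valuation.exists_one_lt_of_le hw a c⁻¹
    obtain ⟨x, hx⟩ := hcof g hg
    set B := w.coarseningContaining g hg.le
    have hB : w.valuationSubring ≤ B := fun z hz ↦
      ⟨0, by simpa using (w.mem_valuationSubring_iff z).1 hz⟩
    have hle : ∀ z, w z ≤ w g → B.valuation z ≤ 1 := fun z hz ↦
      (B.valuation_le_one_iff z).2 ⟨1, by rwa [pow_one]⟩
    have hxB : x ∉ B := fun ⟨n, hn⟩ ↦ (hx n).not_ge hn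
    obtain ⟨b, hb⟩ : ∃ b : K, B.valuation (a - algebraMap K _ b) < 1 := by
      obtain rfl | ha := eq_or_ne a 0
      · exact ⟨0, by simp⟩
      · exact (hIAC.exists_sub_algebraMap_lt (ValuationSubring.isNontrivialValuation hxB) ha).imp
          fun b hb ↦ hb.trans_le (hle a hag)
    refine ⟨b, Valuation.lt_of_valuation_lt_of_le hB (hb.trans_le ?_)⟩
    have := hle _ hcg
    rwa [map_inv₀, inv_le_one₀ (zero_lt_iff.2 (B.valuation.ne_zero_iff.2 hc))] at this
end
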